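/- arXiv:2509.07893 — 6 statements merged into one kernel-verified Lean document; each statement's English description precedes it below -/
import Mathlib

section
/- Young's convolution inequality for tensor series: let p, q, r ≥ 1 be real numbers with 1/p + 1/q = 1 + 1/r. Then for all tensor series x, y in the extended tensor algebra 𝒯 one has ‖x ⊗ y‖_r ≤ ‖x‖_p · ‖y‖_q, where ‖·‖_s denotes the ℓ^s-type norm on tensor levels (the left-hand side being possibly infinite, the inequality holding in [0,∞]). -/
open scoped BigOperators ENNReal
open MeasureTheory

/-- Words of length `n` over the alphabet `{1,…,d}`: indices of a basis of `V^{⊗n}`, `V ≅ ℝ^d`. -/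
abbrev Word (d n : ℕ) := Fin n → Fin d

/-- The extended tensor algebra `𝒯 = ∏_{n ≥ 0} V^{⊗n}` over `V ≅ ℝ^d`, represented by the
coefficients of tensor series in the word basis. -/
abbrev TS (d : ℕ) := ∀ n : ℕ, Word d n → ℝ

namespace TS

variable {d : ℕ}

/-- Euclidean norm `|x^{(n)}|` of the `n`-th homogeneous component. -/
noncomputable def levelNorm (x : TS d) (n : ℕ) : ℝ :=
  Real.sqrt (∑ w : Word d n, (x n w) ^ 2)

/-- The `ℓ^p`-type norm `‖x‖_p = (∑_n |x^{(n)}|^p)^{1/p}`, valued in `[0,∞]`. -/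
noncomputable def pNorm (p : ℝ) (x : TS d) : ℝ≥0∞ :=
  (∑' n : ℕ, ENNReal.ofReal (levelNorm x n) ^ p) ^ (1 / p)

/-- The unit `1` of the tensor algebra. -/
def one : TS d := fun n _ => if n = 0 then 1 else 0

/-- The zero tensor series. -/
def zero : TS d := fun _ _ => 0

def add (x y : TS d) : TS d := fun n w => x n w + y n w

def sub (x y : TS d) : TS d := fun n w => x n w - y n w

def smul (c : ℝ) (x : TS d) : TS d := fun n w => c * x n w

/-- The (concatenation) tensor product: `(x ⊗ y)^{(n)} = ∑_{k=0}^n x^{(k)} ⊗ y^{(n-k)}`. -/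
def mul (x y : TS d) : TS d := fun n w =>
  ∑ k : Fin (n + 1),
    x k.1 (fun i => w ⟨i.1, by have h1 := i.2; have h2 := k.2; omega⟩) *
      y (n - k.1) (fun i => w ⟨k.1 + i.1, by have h1 := i.2; have h2 := k.2; omega⟩)

/-- The dual pairing `⟨x, y⟩ = ∑_n ⟨x^{(n)}, y^{(n)}⟩`. -/
noncomputable def pairing (x y : TS d) : ℝ :=
  ∑' n : ℕ, ∑ w : Word d n, x n w * y n w

/-- Projection `π_m` to the `m`-th homogeneous level. -/
def proj (m : ℕ) (x : TS d) : TS d := fun n w => if n = m then x n w else 0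

/-- Truncation `π_{(0,N)}` to levels `≤ N`. -/
def truncate (N : ℕ) (x : TS d) : TS d := fun n w => if n ≤ N then x n w else 0

/-- Removing the scalar (level-0) component. -/
def reduce (x : TS d) : TS d := fun n w => if n = 0 then 0 else x n w

/-- The dilation `δ_c`, multiplying the `n`-th level by `c^n`. -/
def dil (c : ℝ) (x : TS d) : TS d := fun n w => c ^ n * x n w

/-- The adjoint `x ⊳ z` of left tensor multiplication: `(x ⊳ z)^w = ⟨z, x ⊗ e_w⟩`. -/
noncomputable def adjL (x z : TS d) : TS d := fun n w =>
  ∑' k : ℕ, ∑ v : Word d k, x k v * z (k + n) (Fin.append v w)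

/-- The adjoint `x ⊲ z` of right tensor multiplication: `(x ⊲ z)^w = ⟨z, e_w ⊗ x⟩`. -/
noncomputable def adjR (x z : TS d) : TS d := fun n w =>
  ∑' k : ℕ, ∑ v : Word d k, x k v * z (n + k) (Fin.append w v)

/-- `S` is the free development of the (componentwise a.c.) path `γ = ∫_0^· γ'(u) du` started
at time `s`: it solves, componentwise, `S(t) = 1 + ∫_s^t S(u) ⊗ γ'(u) du`, all components of the
integrand being interval integrable. -/
def IsDev (γ' : ℝ → TS d) (s : ℝ) (S : ℝ → TS d) : Prop :=
  (∀ t n w, IntervalIntegrable (fun u => mul (S u) (γ' u) n w) volume s t) ∧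
    ∀ t, s ≤ t → ∀ n w,
      S t n w = (one : TS d) n w + ∫ u in s..t, mul (S u) (γ' u) n w

end TS


namespace TS

lemma sum_word_split (d n k m : ℕ) (h : n = k + m) (f : Word d k → ℝ) (g : Word d m → ℝ)
    (h1 : ∀ i : Fin k, i.1 < n) (h2 : ∀ i : Fin m, k + i.1 < n) :
    ∑ w : Word d n, f (fun i => w ⟨i.1, h1 i⟩) * g (fun i => w ⟨k + i.1, h2 i⟩)
      = (∑ u, f u) * ∑ v, g v := by
  subst h
  rw [Finset.sum_mul_sum, ← Finset.sum_product', Finset.univ_product_univ]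
  symm
  apply Fintype.sum_equiv (Fin.appendEquiv k m)
  rintro ⟨u, v⟩
  have e1 : (fun i : Fin k => (Fin.appendEquiv k m (u, v)) ⟨i.1, h1 i⟩) = u := by
    funext i
    exact Fin.append_left u v i
  have e2 : (fun i : Fin m => (Fin.appendEquiv k m (u, v)) ⟨k + i.1, h2 i⟩) = v := by
    funext i
    exact Fin.append_right u v i
  rw [e1, e2]

lemma levelNorm_mul_le {d : ℕ} (x y : TS d) (n : ℕ) :
    levelNorm (mul x y) n ≤ ∑ k : Fin (n + 1), levelNorm x k.1 * levelNorm y (n - k.1) := by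
  have key : ∀ z : Word d n → ℝ, Real.sqrt (∑ w, (z w) ^ 2)
      = ‖(WithLp.toLp 2 z : EuclideanSpace ℝ (Word d n))‖ := by
    intro z
    rw [EuclideanSpace.norm_eq]
    simp
  let T : Fin (n + 1) → Word d n → ℝ := fun k w =>
    x k.1 (fun i => w ⟨i.1, by have h1 := i.2; have h2 := k.2; omega⟩) *
      y (n - k.1) (fun i => w ⟨k.1 + i.1, by have h1 := i.2; have h2 := k.2; omega⟩)
  have hT : mul x y n = ∑ k, T k := by
    funext w
    simp [mul, T]
  unfold levelNorm
  rw [key, hT, WithLp.toLp_sum]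
  refine (norm_sum_le _ _).trans (Finset.sum_le_sum fun k _ => ?_)
  rw [← key, ← Real.sqrt_mul (Finset.sum_nonneg fun _ _ => sq_nonneg _)]
  apply le_of_eq
  congr 1
  rw [← sum_word_split d n k.1 (n - k.1) (by have := k.2; omega)
    (fun u => x k.1 u ^ 2) (fun v => y (n - k.1) v ^ 2)
    (fun i => by have h1 := i.2; have h2 := k.2; omega)
    (fun i => by have h1 := i.2; have h2 := k.2; omega)]
  simp only [T, mul_pow]

lemma holder3 {n : ℕ} (f g h : Fin n → ℝ≥0∞) {α β γ : ℝ} (hα : 0 ≤ α) (hβ : 0 ≤ β)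
    (hγ : 0 ≤ γ) (hs : α + β + γ = 1) :
    ∑ k, f k ^ α * g k ^ β * h k ^ γ
      ≤ (∑ k, f k) ^ α * (∑ k, g k) ^ β * (∑ k, h k) ^ γ := by
  have := ENNReal.lintegral_prod_norm_pow_le (μ := (Measure.count : Measure (Fin n)))
    (Finset.univ : Finset (Fin 3)) (f := ![f, g, h])
    (fun i _ => (measurable_of_finite _).aemeasurable)
    (p := ![α, β, γ]) (by simp [Fin.sum_univ_three, hs])
    (by intro i _; fin_cases i <;> simpa)
  simpa [Fin.prod_univ_three, lintegral_count, tsum_fintype] using this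

lemma tsum_conv (a b : ℕ → ℝ≥0∞) :
    ∑' n, ∑ k : Fin (n + 1), a k.1 * b (n - k.1) = (∑' n, a n) * ∑' n, b n := by
  let e : (Σ n : ℕ, Fin (n + 1)) ≃ ℕ × ℕ :=
    { toFun := fun z => (z.2.1, z.1 - z.2.1)
      invFun := fun z => ⟨z.1 + z.2, ⟨z.1, by omega⟩⟩
      left_inv := by
        rintro ⟨n, k, hk⟩
        obtain ⟨m, rfl⟩ : ∃ m, n = k + m := ⟨n - k, by omega⟩
        have hm : k + m - k = m := by omega
        simp only
        rw! [hm]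
        rfl
      right_inv := by
        rintro ⟨i, j⟩
        simp }
  calc _ = ∑' z : (Σ n : ℕ, Fin (n + 1)), a z.2.1 * b (z.1 - z.2.1) := by
        rw [ENNReal.tsum_sigma (fun (n : ℕ) (k : Fin (n + 1)) => a k.1 * b (n - k.1))]
        simp_rw [tsum_fintype]
    _ = ∑' z : ℕ × ℕ, a z.1 * b z.2 := e.tsum_eq (fun z : ℕ × ℕ => a z.1 * b z.2)
    _ = _ := by
        rw [ENNReal.tsum_prod (f := fun i j => a i * b j)]
        simp_rw [ENNReal.tsum_mul_left, ENNReal.tsum_mul_right]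

lemma young_scalar {p q r : ℝ} (hp : 1 ≤ p) (hq : 1 ≤ q) (hr : 1 ≤ r)
    (hpqr : 1 / p + 1 / q = 1 + 1 / r) (a b : ℕ → ℝ≥0∞) :
    (∑' n, (∑ k : Fin (n + 1), a k.1 * b (n - k.1)) ^ r) ^ (1 / r)
      ≤ (∑' n, a n ^ p) ^ (1 / p) * (∑' n, b n ^ q) ^ (1 / q) := by
  have hp0 : 0 < p := by linarith
  have hq0 : 0 < q := by linarith
  have hr0 : 0 < r := by linarith
  have ip : 1 / p ≤ 1 := by rw [div_le_one hp0]; exact hp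
  have iq : 1 / q ≤ 1 := by rw [div_le_one hq0]; exact hq
  have ir : 0 ≤ 1 / r := by positivity
  have hβ : 0 ≤ 1 / p - 1 / r := by linarith
  have hγ : 0 ≤ 1 / q - 1 / r := by linarith
  set A := ∑' n, a n ^ p with hA
  set B := ∑' n, b n ^ q with hB
  have split : ∀ (X : ℝ≥0∞) (s : ℝ), 0 ≤ s - 1 / r →
      X ^ (1 / r) * X ^ (s - 1 / r) = X ^ s := by
    intro X s hs
    rw [← ENNReal.rpow_add_of_nonneg _ _ ir hs]
    congr 1
    ring
  have root : ∀ (X : ℝ≥0∞) (s : ℝ), 0 < s → (X ^ s) ^ (1 / s) = X := by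
    intro X s hs
    rw [← ENNReal.rpow_mul, mul_one_div_cancel hs.ne', ENNReal.rpow_one]
  have pt : ∀ X Y : ℝ≥0∞, X * Y
      = (X ^ p * Y ^ q) ^ (1 / r) * (X ^ p) ^ (1 / p - 1 / r) * (Y ^ q) ^ (1 / q - 1 / r) := by
    intro X Y
    rw [ENNReal.mul_rpow_of_nonneg _ _ ir]
    calc X * Y = (X ^ p) ^ (1 / p) * (Y ^ q) ^ (1 / q) := by rw [root X p hp0, root Y q hq0]
      _ = _ := by rw [← split _ _ hβ, ← split _ _ hγ]; ring
  have step : ∀ n, (∑ k : Fin (n + 1), a k.1 * b (n - k.1)) ^ r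
      ≤ (∑ k : Fin (n + 1), a k.1 ^ p * b (n - k.1) ^ q)
        * (A ^ (1 / p - 1 / r) * B ^ (1 / q - 1 / r)) ^ r := by
    intro n
    have hA' : ∑ k : Fin (n + 1), a k.1 ^ p ≤ A := by
      rw [Fin.sum_univ_eq_sum_range (fun k => a k ^ p)]
      exact ENNReal.sum_le_tsum _
    have hB' : ∑ k : Fin (n + 1), b (n - k.1) ^ q ≤ B := by
      rw [Fin.sum_univ_eq_sum_range (fun k => b (n - k) ^ q)]
      have := Finset.sum_range_reflect (fun k => b k ^ q) (n + 1)
      simp only [Nat.add_sub_cancel] at this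
      rw [this]
      exact ENNReal.sum_le_tsum _
    have h0 : ∑ k : Fin (n + 1), a k.1 * b (n - k.1)
        ≤ (∑ k : Fin (n + 1), a k.1 ^ p * b (n - k.1) ^ q) ^ (1 / r)
          * (A ^ (1 / p - 1 / r) * B ^ (1 / q - 1 / r)) := by
      rw [Finset.sum_congr rfl fun k _ => pt (a k.1) (b (n - k.1)), ← mul_assoc]
      refine (holder3 _ _ _ ir hβ hγ (by linarith)).trans ?_
      gcongr
    calc _ ≤ _ := ENNReal.rpow_le_rpow h0 hr0.le
      _ = _ := by
        rw [ENNReal.mul_rpow_of_nonneg _ _ hr0.le, ← ENNReal.rpow_mul,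
          one_div_mul_cancel hr0.ne', ENNReal.rpow_one]
  calc _ ≤ (A * B * (A ^ (1 / p - 1 / r) * B ^ (1 / q - 1 / r)) ^ r) ^ (1 / r) := by
        refine ENNReal.rpow_le_rpow ((ENNReal.tsum_le_tsum step).trans ?_) ir
        rw [ENNReal.tsum_mul_right, tsum_conv (fun n => a n ^ p) (fun n => b n ^ q)]
    _ = _ := by
        rw [ENNReal.mul_rpow_of_nonneg _ _ ir, root _ r hr0, ENNReal.mul_rpow_of_nonneg _ _ ir,
          ← split A _ hβ, ← split B _ hγ]
        ring

end TS

theorem young_convolution_tensor (d : ℕ) (p q r : ℝ)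
    (hp : 1 ≤ p) (hq : 1 ≤ q) (hr : 1 ≤ r)
    (hpqr : 1 / p + 1 / q = 1 + 1 / r) (x y : TS d) :
    TS.pNorm r (TS.mul x y) ≤ TS.pNorm p x * TS.pNorm q y := by
  have nn : ∀ (z : TS d) n, 0 ≤ TS.levelNorm z n := fun z n => Real.sqrt_nonneg _
  refine le_trans ?_ (TS.young_scalar hp hq hr hpqr
    (fun n => ENNReal.ofReal (TS.levelNorm x n)) (fun n => ENNReal.ofReal (TS.levelNorm y n)))
  unfold TS.pNorm
  refine ENNReal.rpow_le_rpow (ENNReal.tsum_le_tsum fun n => ?_) (by positivity)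
  refine ENNReal.rpow_le_rpow ?_ (by linarith)
  refine (ENNReal.ofReal_le_ofReal (TS.levelNorm_mul_le x y n)).trans (le_of_eq ?_)
  rw [ENNReal.ofReal_sum_of_nonneg fun k _ => mul_nonneg (nn _ _) (nn _ _)]
  exact Finset.sum_congr rfl fun k _ => ENNReal.ofReal_mul (nn _ _)
end

section
/- 𝒯^2 is not closed under the tensor product: for d = 1 and any β ∈ (1/2, 3/4], the tensor series x = ∑_{n≥1} n^{−β} e_1^{⊗n} satisfies ‖x‖_2 < ∞ but ‖x ⊗ x‖_2 = ∞; indeed |π_n(x^{⊗2})| = ∑_{k=1}^{n−1} k^{−β}(n−k)^{−β} ≥ (n/2)^{1−2β} for every n ≥ 2. -/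
open scoped BigOperators ENNReal
open MeasureTheory

/-- The tensor series `x = ∑_{n ≥ 1} n^{-β} e_1^{⊗n}` over `V ≅ ℝ` (`d = 1`). -/
noncomputable def xSeries (β : ℝ) : TS 1 := fun n _ => if n = 0 then 0 else (n : ℝ) ^ (-β)

lemma levelNorm_one (x : TS 1) (n : ℕ) (w : Word 1 n) : TS.levelNorm x n = |x n w| := by
  unfold TS.levelNorm
  rw [Fintype.sum_subsingleton _ w, Real.sqrt_sq_eq_abs]

lemma level_mul (β : ℝ) (n : ℕ) (hn : 2 ≤ n) :
    TS.levelNorm (TS.mul (xSeries β) (xSeries β)) n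
          = ∑ k ∈ Finset.Ico 1 n, (k : ℝ) ^ (-β) * ((n - k : ℕ) : ℝ) ^ (-β) := by
  rw [levelNorm_one _ n (fun _ => 0)]
  have h : TS.mul (xSeries β) (xSeries β) n (fun _ => 0)
      = ∑ k ∈ Finset.Ico 1 n, (k : ℝ) ^ (-β) * ((n - k : ℕ) : ℝ) ^ (-β) := by
    unfold TS.mul xSeries
    rw [Fin.sum_univ_eq_sum_range (fun k : ℕ => (if k = 0 then (0:ℝ) else (k : ℝ) ^ (-β)) *
      (if n - k = 0 then (0:ℝ) else ((n - k : ℕ) : ℝ) ^ (-β))) (n + 1)]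
    symm
    apply Finset.sum_subset_zero_on_sdiff
    · intro k hk
      simp only [Finset.mem_Ico, Finset.mem_range] at *
      omega
    · intro k hk
      simp only [Finset.mem_Ico, Finset.mem_range, Finset.mem_sdiff] at hk
      rcases Nat.eq_zero_or_pos k with h | h
      · simp [h]
      · have : n - k = 0 := by omega
        simp [this]
    · intro k hk
      simp only [Finset.mem_Ico] at hk
      rw [if_neg (by omega), if_neg (by omega)]
  rw [h, abs_of_nonneg]
  exact Finset.sum_nonneg fun k _ => by positivity

lemma level_lower (β : ℝ) (hβ : 1 / 2 < β) (n : ℕ) (hn : 2 ≤ n) :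
    ((n : ℝ) / 2) ^ (1 - 2 * β)
          ≤ TS.levelNorm (TS.mul (xSeries β) (xSeries β)) n := by
  rw [level_mul β n hn]
  have hn' : (2:ℝ) ≤ n := by exact_mod_cast hn
  have hpos : (0:ℝ) < (n:ℝ) / 2 := by linarith
  have h1 : ∀ k ∈ Finset.Ico 1 n, ((n:ℝ)/2) ^ (-(2*β)) ≤
      (k : ℝ) ^ (-β) * ((n - k : ℕ) : ℝ) ^ (-β) := by
    intro k hk
    rw [Finset.mem_Ico] at hk
    have hk1 : (0:ℝ) < k := by exact_mod_cast hk.1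
    have hk2 : (0:ℝ) < ((n - k : ℕ) : ℝ) := by
      have : 0 < n - k := by omega
      exact_mod_cast this
    rw [← Real.mul_rpow hk1.le hk2.le,
      show -(2*β) = ((2:ℕ):ℝ) * (-β) by push_cast; ring, Real.rpow_mul hpos.le,
      Real.rpow_natCast]
    apply Real.rpow_le_rpow_of_nonpos (by positivity) _ (by linarith)
    rw [Nat.cast_sub hk.2.le]
    nlinarith [sq_nonneg ((n:ℝ) - 2 * k)]
  have h2 := Finset.card_nsmul_le_sum _ _ _ h1
  refine le_trans ?_ h2
  rw [Nat.card_Ico, nsmul_eq_mul, Nat.cast_sub (by omega), sub_eq_add_neg 1 (2*β),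
    Real.rpow_add hpos, Real.rpow_one]
  apply mul_le_mul_of_nonneg_right _ (by positivity)
  push_cast
  linarith

/-- **`𝒯^2` is not closed under the tensor product**: for `d = 1` and `β ∈ (1/2, 3/4]`, the
series `x = ∑_{n ≥ 1} n^{-β} e_1^{⊗n}` satisfies `‖x‖_2 < ∞` but `‖x ⊗ x‖_2 = ∞`; indeed
`|π_n(x^{⊗2})| = ∑_{k=1}^{n-1} k^{-β} (n-k)^{-β} ≥ (n/2)^{1-2β}` for every `n ≥ 2`. -/
theorem T2_not_an_algebra (β : ℝ) (hβ : 1 / 2 < β) (hβ' : β ≤ 3 / 4) :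
    TS.pNorm 2 (xSeries β) < ⊤ ∧
    TS.pNorm 2 (TS.mul (xSeries β) (xSeries β)) = ⊤ ∧
    ∀ n : ℕ, 2 ≤ n →
      TS.levelNorm (TS.mul (xSeries β) (xSeries β)) n
          = ∑ k ∈ Finset.Ico 1 n, (k : ℝ) ^ (-β) * ((n - k : ℕ) : ℝ) ^ (-β) ∧
      ((n : ℝ) / 2) ^ (1 - 2 * β)
          ≤ TS.levelNorm (TS.mul (xSeries β) (xSeries β)) n := by
  refine ⟨?_, ?_, fun n hn => ⟨level_mul β n hn, level_lower β hβ n hn⟩⟩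
  · unfold TS.pNorm
    apply ENNReal.rpow_lt_top_of_nonneg (by norm_num)
    have hs : Summable (fun n : ℕ => (n : ℝ) ^ (-(2 * β))) :=
      Real.summable_nat_rpow.2 (by linarith)
    refine ne_top_of_le_ne_top hs.tsum_ofReal_ne_top (ENNReal.tsum_le_tsum fun n => ?_)
    rw [levelNorm_one _ n (fun _ => 0), ENNReal.ofReal_rpow_of_nonneg (abs_nonneg _) (by norm_num)]
    apply ENNReal.ofReal_le_ofReal
    unfold xSeries
    split_ifs with h
    · simp only [abs_zero]
      rw [Real.zero_rpow (by norm_num)]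
      positivity
    · rw [abs_of_nonneg (by positivity), ← Real.rpow_mul (by positivity)]
      apply le_of_eq
      congr 1
      ring
  · unfold TS.pNorm
    suffices h : (∑' n : ℕ, ENNReal.ofReal
        (TS.levelNorm (TS.mul (xSeries β) (xSeries β)) n) ^ (2:ℝ)) = ⊤ by
      rw [h]
      exact ENNReal.top_rpow_of_pos (by norm_num)
    by_contra hne
    have hb : ∀ n : ℕ, ENNReal.ofReal (1 / ((n + 2 : ℕ) : ℝ)) ≤ ENNReal.ofReal
        (TS.levelNorm (TS.mul (xSeries β) (xSeries β)) (n + 2)) ^ (2:ℝ) := by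
      intro n
      have hl := level_lower β hβ (n + 2) (by omega)
      have hn' : (2:ℝ) ≤ ((n + 2 : ℕ) : ℝ) := by push_cast; linarith [n.cast_nonneg (α := ℝ)]
      generalize ((n + 2 : ℕ) : ℝ) = m at hl hn'
      have hp : 0 ≤ (m / 2) ^ (1 - 2 * β) := Real.rpow_nonneg (by linarith) _
      rw [ENNReal.ofReal_rpow_of_nonneg (hp.trans hl) (by norm_num)]
      apply ENNReal.ofReal_le_ofReal
      calc 1 / m ≤ (m / 2) ^ (-1 : ℝ) := by
            rw [Real.rpow_neg_one, inv_div]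
            gcongr
            norm_num
        _ ≤ (m / 2) ^ ((1 - 2 * β) * 2) :=
            Real.rpow_le_rpow_of_exponent_le (by linarith) (by linarith)
        _ = ((m / 2) ^ (1 - 2 * β)) ^ (2:ℝ) := Real.rpow_mul (by linarith) _ _
        _ ≤ _ := Real.rpow_le_rpow hp hl (by norm_num)
    have h1 : (∑' n : ℕ, ENNReal.ofReal (1 / ((n + 2 : ℕ) : ℝ))) ≠ ⊤ := by
      refine ne_top_of_le_ne_top hne ((ENNReal.tsum_le_tsum hb).trans ?_)
      exact ENNReal.tsum_comp_le_tsum_of_injective (add_left_injective 2) (fun n =>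
        ENNReal.ofReal (TS.levelNorm (TS.mul (xSeries β) (xSeries β)) n) ^ (2:ℝ))
    have h2 := ENNReal.summable_toReal h1
    have h3 : Summable (fun n : ℕ => 1 / ((n + 2 : ℕ) : ℝ)) := by
      refine h2.congr fun n => ?_
      rw [ENNReal.toReal_ofReal (by positivity)]
    exact Real.not_summable_one_div_natCast
      ((summable_nat_add_iff (f := fun n : ℕ => 1 / (n : ℝ)) 2).1 h3)
end

section
/- Bell polynomial bound for the free development: let γ : [0,∞) → 𝒯_0 be componentwise absolutely continuous and let t ≥ s ≥ 0. Then for every n ≥ 1, |π_n 𝒮(γ)_{s,t}| ≤ (1/n!) · B_n(1!·V_1, 2!·V_2, …, n!·V_n), where V_k := ∫_s^t |π_k γ̇(u)| du and B_n is the n-th complete exponential Bell polynomial, B_n(y_1,…,y_n) = n! ∑_{ℓ∈ℕ^n: ℓ_1+2ℓ_2+⋯+nℓ_n = n} ∏_{i=1}^n y_i^{ℓ_i}/((i!)^{ℓ_i} ℓ_i!). -/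
open scoped BigOperators ENNReal
open MeasureTheory

/-- The `n`-th complete exponential Bell polynomial,
`B_n(y_1,…,y_n) = n! ∑_{ℓ ∈ ℕ^n : ∑ i ℓ_i = n} ∏_{i=1}^n y_i^{ℓ_i} / ((i!)^{ℓ_i} ℓ_i!)`. -/
noncomputable def bellPoly (n : ℕ) (y : ℕ → ℝ) : ℝ :=
  (n.factorial : ℝ) *
    ∑ ℓ : Fin n → Fin (n + 1),
      if (∑ i : Fin n, (i.1 + 1) * (ℓ i).1) = n then
        ∏ i : Fin n,
          y (i.1 + 1) ^ (ℓ i).1 /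
            (((i.1 + 1).factorial : ℝ) ^ (ℓ i).1 * ((ℓ i).1.factorial : ℝ))
      else 0

section Helpers
open PowerSeries

def GoodPS (a b : ℝ) (F h : ℝ → PowerSeries ℝ) : Prop :=
  (∀ n, AbsolutelyContinuousOnInterval (fun u => coeff n (F u)) a b) ∧
    ∀ᵐ u : ℝ, u ∈ Set.uIcc a b → ∀ n,
      HasDerivAt (fun v => coeff n (F v)) (coeff n (h u * F u)) u

lemma ac_const (c a b : ℝ) : AbsolutelyContinuousOnInterval (fun _ : ℝ => c) a b :=
  (contDiffOn_const).absolutelyContinuousOnInterval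

lemma ac_sum {ι : Type*} (s : Finset ι) (f : ι → ℝ → ℝ) (a b : ℝ)
    (h : ∀ i ∈ s, AbsolutelyContinuousOnInterval (f i) a b) :
    AbsolutelyContinuousOnInterval (fun u => ∑ i ∈ s, f i u) a b := by
  classical
  induction s using Finset.induction_on with
  | empty => simpa using ac_const 0 a b
  | insert i s hi ih =>
    simp only [Finset.sum_insert hi]
    exact (h i (by simp)).fun_add (ih fun j hj => h j (by simp [hj]))

lemma ac_pow (f : ℝ → ℝ) (a b : ℝ) (h : AbsolutelyContinuousOnInterval f a b) (n : ℕ) :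
    AbsolutelyContinuousOnInterval (fun u => f u ^ n) a b := by
  induction n with
  | zero => simpa using ac_const 1 a b
  | succ n ih => simpa only [pow_succ] using ih.fun_mul h

lemma GoodPS.mul {a b : ℝ} {F G h k : ℝ → PowerSeries ℝ} (hF : GoodPS a b F h)
    (hG : GoodPS a b G k) : GoodPS a b (fun u => F u * G u) (fun u => h u + k u) := by
  refine ⟨fun n => ?_, ?_⟩
  · simp only [coeff_mul]
    exact ac_sum _ _ _ _ fun p _ => (hF.1 _).fun_mul (hG.1 _)
  · filter_upwards [hF.2, hG.2] with u h1 h2 hu n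
    have : (h u + k u) * (F u * G u) = (h u * F u) * G u + F u * (k u * G u) := by ring
    rw [this, map_add]
    simp only [coeff_mul _ (_ * _) (G u), coeff_mul _ (F u) (_ * _), coeff_mul _ (F _) (G _)]
    rw [← Finset.sum_add_distrib]
    exact HasDerivAt.fun_sum fun p _ => (h1 hu p.1).mul (h2 hu p.2)

lemma GoodPS.one (a b : ℝ) : GoodPS a b (fun _ => 1) (fun _ => 0) := by
  refine ⟨fun n => ac_const _ _ _, ?_⟩
  filter_upwards with u hu n
  simpa using hasDerivAt_const u _

lemma GoodPS.prod {ι : Type*} (s : Finset ι) {a b : ℝ} {F h : ι → ℝ → PowerSeries ℝ}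
    (H : ∀ i ∈ s, GoodPS a b (F i) (h i)) :
    GoodPS a b (fun u => ∏ i ∈ s, F i u) (fun u => ∑ i ∈ s, h i u) := by
  classical
  induction s using Finset.induction_on with
  | empty => simpa using GoodPS.one a b
  | insert i s hi ih =>
    simp only [Finset.sum_insert hi, Finset.prod_insert hi]
    exact (H i (by simp)).mul (ih fun j hj => H j (by simp [hj]))

noncomputable def expPS (i : ℕ) (x : ℝ) : PowerSeries ℝ :=
  PowerSeries.mk fun n => if i ∣ n then x ^ (n / i) / ((n / i).factorial : ℝ) else 0

lemma expPS_good (i : ℕ) (hi : 0 < i) {a b : ℝ} {V g : ℝ → ℝ}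
    (hV : AbsolutelyContinuousOnInterval V a b)
    (hd : ∀ᵐ u : ℝ, u ∈ Set.uIcc a b → HasDerivAt V (g u) u) :
    GoodPS a b (fun u => expPS i (V u)) (fun u => C (g u) * X ^ i) := by
  refine ⟨fun n => ?_, ?_⟩
  · simp only [expPS, coeff_mk]
    split_ifs
    · simp only [div_eq_inv_mul]
      exact (ac_pow _ _ _ hV _).const_mul _
    · exact ac_const _ _ _
  · filter_upwards [hd] with u hu hm n
    rw [mul_assoc, coeff_C_mul, coeff_X_pow_mul']
    simp only [expPS, coeff_mk]
    by_cases hn : i ∣ n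
    · obtain ⟨l, rfl⟩ := hn
      have h1 := (hu hm).pow l
      cases l with
      | zero => simpa [hi.ne'] using hasDerivAt_const u (1:ℝ)
      | succ l =>
        have e1 : i * (l + 1) - i = i * l := by rw [mul_add, mul_one, Nat.add_sub_cancel]
        have e2 : i ≤ i * (l + 1) := Nat.le_mul_of_pos_right _ (by omega)
        rw [if_pos e2, e1]
        simp only [dvd_mul_right, if_true, Nat.mul_div_cancel_left _ hi]
        have h2 := h1.div_const ((l + 1).factorial : ℝ)
        have e3 : ((l + 1 : ℕ) : ℝ) * V u ^ (l + 1 - 1) * g u / ((l + 1).factorial : ℝ) =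
            g u * (V u ^ l / (l.factorial : ℝ)) := by
          rw [Nat.factorial_succ]
          push_cast
          have := Nat.factorial_ne_zero l
          field_simp
        rw [e3] at h2
        exact h2
    · simp only [hn, if_false]
      have : ¬ (i ≤ n ∧ i ∣ n - i) := by
        rintro ⟨h1, h2⟩
        have h3 := Nat.dvd_add h2 (dvd_refl i)
        rw [Nat.sub_add_cancel h1] at h3
        exact hn h3
      split_ifs with h1 h2
      · exact absurd ⟨h1, h2⟩ this
      · simpa using hasDerivAt_const u (0:ℝ)
      · simpa using hasDerivAt_const u (0:ℝ)

lemma coeff_prod_nonneg {ι : Type*} (s : Finset ι) (F : ι → PowerSeries ℝ)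
    (h : ∀ i ∈ s, ∀ n, 0 ≤ coeff n (F i)) (n : ℕ) : 0 ≤ coeff n (∏ i ∈ s, F i) := by
  classical
  rw [PowerSeries.coeff_prod]
  exact Finset.sum_nonneg fun l _ => Finset.prod_nonneg fun i hi => h i hi _

lemma expPS_nonneg (i : ℕ) (x : ℝ) (hx : 0 ≤ x) (n : ℕ) : 0 ≤ coeff n (expPS i x) := by
  simp only [expPS, coeff_mk]
  split_ifs <;> positivity

lemma bell_eq (n : ℕ) (V : ℕ → ℝ) :
    (1 / (n.factorial : ℝ)) * bellPoly n (fun k => (k.factorial : ℝ) * V k) =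
      coeff n (∏ i : Fin n, expPS (i.1 + 1) (V (i.1 + 1))) := by
  classical
  have hf : (n.factorial : ℝ) ≠ 0 := by exact_mod_cast Nat.factorial_ne_zero n
  rw [bellPoly, ← mul_assoc, one_div, inv_mul_cancel₀ hf, one_mul, PowerSeries.coeff_prod,
    ← Finset.sum_filter]
  refine Finset.sum_of_injOn
    (fun ℓ : Fin n → Fin (n + 1) => Finsupp.equivFunOnFinite.symm (fun i : Fin n => (i.1 + 1) * (ℓ i).1)) ?_ ?_ ?_ ?_
  · intro x _ y _ hxy
    funext i
    have := DFunLike.congr_fun hxy i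
    simp only [Finsupp.equivFunOnFinite_symm_apply_apply] at this
    exact Fin.ext (Nat.eq_of_mul_eq_mul_left (by omega) this)
  · intro x hx
    simp only [Finset.coe_filter, Finset.mem_univ, true_and, Set.mem_ofPred_eq] at hx
    simp [Finset.mem_finsuppAntidiag, hx]
  · intro l hl hl'
    by_contra hne
    apply hl'
    have hdiv : ∀ i : Fin n, (i.1 + 1) ∣ l i := by
      intro i
      by_contra hi
      exact hne (Finset.prod_eq_zero (Finset.mem_univ i) (by simp [expPS, hi]))
    have hsum : ∑ i : Fin n, l i = n := by
      simpa [Finset.mem_finsuppAntidiag] using hl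
    have hle : ∀ i, l i ≤ n := fun i => by
      refine le_trans ?_ hsum.le
      exact Finset.single_le_sum (f := fun i => l i) (fun _ _ => Nat.zero_le _) (Finset.mem_univ i)
    refine ⟨fun i => ⟨l i / (i.1 + 1), by
      have := Nat.div_le_self (l i) (i.1 + 1); have := hle i; omega⟩, ?_, ?_⟩
    · simp only [Finset.coe_filter, Finset.mem_univ, true_and, Set.mem_ofPred_eq]
      refine Eq.trans ?_ hsum
      exact Finset.sum_congr rfl fun i _ => by rw [Nat.mul_div_cancel' (hdiv i)]
    · ext i
      simp [Nat.mul_div_cancel' (hdiv i)]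
  · intro ℓ _
    refine Finset.prod_congr rfl fun i _ => ?_
    have : ((i.1 + 1).factorial : ℝ) ≠ 0 := by exact_mod_cast Nat.factorial_ne_zero _
    simp only [expPS, coeff_mk, Finsupp.equivFunOnFinite_symm_apply_apply, dvd_mul_right, if_true,
      Nat.mul_div_cancel_left _ (Nat.succ_pos i.1)]
    rw [mul_pow]
    field_simp

lemma levelNorm_eq {d : ℕ} (x : TS d) (n : ℕ) :
    TS.levelNorm x n = ‖(WithLp.toLp 2 (x n) : EuclideanSpace ℝ (Word d n))‖ := by
  rw [EuclideanSpace.norm_eq, TS.levelNorm]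
  simp

lemma levelNorm_nonneg {d : ℕ} (x : TS d) (n : ℕ) : 0 ≤ TS.levelNorm x n := Real.sqrt_nonneg _

lemma tensor_norm {d : ℕ} (k j m : ℕ) (h : m = k + j) (x : Word d k → ℝ) (y : Word d j → ℝ) :
    Real.sqrt (∑ w : Word d m, (x (fun i => w ⟨i.1, by omega⟩) *
      y (fun i => w ⟨k + i.1, by omega⟩)) ^ 2) =
    Real.sqrt (∑ w, x w ^ 2) * Real.sqrt (∑ w, y w ^ 2) := by
  subst h
  rw [← Real.sqrt_mul (Finset.sum_nonneg fun _ _ => sq_nonneg _), Finset.sum_mul_sum,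
    ← Finset.sum_product', Finset.univ_product_univ]
  congr 1
  symm
  refine Fintype.sum_equiv (Fin.appendEquiv k j) _ _ fun p => ?_
  have e1 : (fun i : Fin k => Fin.append p.1 p.2 ⟨i.1, by omega⟩) = p.1 := by
    funext i
    exact Fin.append_left p.1 p.2 i
  have e2 : (fun i : Fin j => Fin.append p.1 p.2 ⟨k + i.1, by omega⟩) = p.2 := by
    funext i
    exact Fin.append_right p.1 p.2 i
  simp only [Fin.appendEquiv, Equiv.coe_fn_mk, e1, e2, mul_pow]

lemma levelNorm_mul_le {d : ℕ} (x y : TS d) (m : ℕ) :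
    TS.levelNorm (TS.mul x y) m ≤
      ∑ k ∈ Finset.range (m + 1), TS.levelNorm x k * TS.levelNorm y (m - k) := by
  rw [Finset.sum_range, levelNorm_eq]
  have : (WithLp.toLp 2 (TS.mul x y m) : EuclideanSpace ℝ (Word d m)) =
      ∑ k : Fin (m + 1), WithLp.toLp 2 (fun w : Word d m =>
        x k.1 (fun i => w ⟨i.1, by have h1 := i.2; have h2 := k.2; omega⟩) *
      y (m - k.1) (fun i => w ⟨k.1 + i.1, by have h1 := i.2; have h2 := k.2; omega⟩)) := by
    ext w
    simp [TS.mul]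
  rw [this]
  refine (norm_sum_le _ _).trans (Finset.sum_le_sum fun k _ => ?_)
  rw [EuclideanSpace.norm_eq]
  simp only [Real.norm_eq_abs, sq_abs]
  exact (tensor_norm k.1 (m - k.1) m (by have := k.2; omega) (x k.1) (y (m - k.1))).le

lemma levelNorm_integrable {d : ℕ} (f : ℝ → TS d) (a b : ℝ) (n : ℕ)
    (h : ∀ w, IntervalIntegrable (fun u => f u n w) volume a b) :
    IntervalIntegrable (fun u => TS.levelNorm (f u) n) volume a b := by
  simp only [levelNorm_eq]
  constructor
  · exact (Integrable.of_eval_piLp (f := fun u => (WithLp.toLp 2 (f u n) : EuclideanSpace ℝ (Word d n)))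
      fun w => (h w).1).norm
  · exact (Integrable.of_eval_piLp (f := fun u => (WithLp.toLp 2 (f u n) : EuclideanSpace ℝ (Word d n)))
      fun w => (h w).2).norm

lemma levelNorm_integral_le {d : ℕ} (f : ℝ → TS d) (x : TS d) (a b : ℝ) (hab : a ≤ b) (n : ℕ)
    (h : ∀ w, IntervalIntegrable (fun u => f u n w) volume a b)
    (hx : ∀ w, x n w = ∫ u in a..b, f u n w) (G : ℝ → ℝ)
    (hG : IntervalIntegrable G volume a b)
    (hle : ∀ᵐ u : ℝ, u ∈ Set.Ioc a b → TS.levelNorm (f u) n ≤ G u) :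
    TS.levelNorm x n ≤ ∫ u in a..b, G u := by
  rw [levelNorm_eq]
  have : (WithLp.toLp 2 (x n) : EuclideanSpace ℝ (Word d n)) =
      ∫ u in a..b, (WithLp.toLp 2 (f u n) : EuclideanSpace ℝ (Word d n)) := by
    ext w
    rw [intervalIntegral.integral_of_le hab, eval_integral_piLp
      (f := fun u => (WithLp.toLp 2 (f u n) : EuclideanSpace ℝ (Word d n))) fun w => (h w).1]
    simp only [hx, intervalIntegral.integral_of_le hab]
  rw [this]
  refine intervalIntegral.norm_integral_le_of_norm_le hab ?_ hG
  simpa only [levelNorm_eq] using hle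

lemma coeff_h (N m : ℕ) (hm : m ≤ N) (hm1 : 1 ≤ m) (c : ℕ → ℝ) (F : PowerSeries ℝ) (hc : c 0 = 0) :
    coeff m ((∑ i : Fin N, C (c (i.1 + 1)) * X ^ (i.1 + 1)) * F) =
      ∑ k ∈ Finset.range (m + 1), coeff k F * c (m - k) := by
  rw [mul_comm, coeff_mul, Finset.Nat.sum_antidiagonal_eq_sum_range_succ
    (fun i j => coeff i F * coeff j (∑ i : Fin N, C (c (i.1 + 1)) * X ^ (i.1 + 1)))]
  refine Finset.sum_congr rfl fun k hk => ?_
  congr 1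
  have hk' : m - k ≤ N := by omega
  generalize m - k = j at hk'
  simp only [map_sum, coeff_C_mul, coeff_X_pow, mul_ite, mul_one, mul_zero]
  rw [Finset.sum_fin_eq_sum_range]
  cases j with
  | zero => simp [hc]
  | succ j =>
    rw [Finset.sum_eq_single j]
    · simp [show j < N by omega]
    · intro b _ hb
      split_ifs with h1 h2
      · simp only at h2
        omega
      · rfl
      · rfl
    · intro h
      exact absurd (Finset.mem_range.2 (by omega)) h

lemma main_bound (d : ℕ) (γ' : ℝ → TS d)
    (hγ0 : ∀ u w, γ' u 0 w = 0)
    (hγint : ∀ a b n w, IntervalIntegrable (fun u => γ' u n w) volume a b)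
    (s : ℝ) (S : ℝ → TS d) (hS : TS.IsDev γ' s S) (N : ℕ) (m : ℕ) (hm : m ≤ N) :
    ∀ t, s ≤ t → TS.levelNorm (S t) m ≤
      coeff m (∏ i : Fin N, expPS (i.1 + 1) (∫ u in s..t, TS.levelNorm (γ' u) (i.1 + 1))) := by
  induction m using Nat.strong_induction_on with
  | _ m ih =>
  intro t hst
  have hg : ∀ k, IntervalIntegrable (fun u => TS.levelNorm (γ' u) k) volume s t :=
    fun k => levelNorm_integrable γ' s t k fun w => hγint s t k w
  have hγn : ∀ u, TS.levelNorm (γ' u) 0 = 0 := fun u => by simp [TS.levelNorm, hγ0]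
  have hV : ∀ u, s ≤ u → ∀ n, 0 ≤ coeff n (∏ i : Fin N, expPS (i.1 + 1)
      (∫ u in s..u, TS.levelNorm (γ' u) (i.1 + 1))) := fun u hu n =>
    coeff_prod_nonneg _ _ (fun i _ n => expPS_nonneg _ _
      (intervalIntegral.integral_nonneg hu fun _ _ => levelNorm_nonneg _ _) n) n
  have hgood : GoodPS s t
      (fun u => ∏ i : Fin N, expPS (i.1 + 1) (∫ u in s..u, TS.levelNorm (γ' u) (i.1 + 1)))
      (fun u => ∑ i : Fin N, C (TS.levelNorm (γ' u) (i.1 + 1)) * X ^ (i.1 + 1)) := by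
    refine GoodPS.prod Finset.univ fun i _ => expPS_good (i.1 + 1) (Nat.succ_pos _)
      ((hg _).absolutelyContinuousOnInterval_intervalIntegral Set.left_mem_uIcc) ?_
    filter_upwards [(hg (i.1 + 1)).ae_hasDerivAt_integral] with u h hu
    exact h hu s Set.left_mem_uIcc
  rcases Nat.eq_zero_or_pos m with rfl | hm1
  · have h1 : ∀ w, S t 0 w = 1 := by
      intro w
      rw [hS.2 t hst 0 w]
      simp [TS.mul, TS.one, hγ0]
    have h2 : TS.levelNorm (S t) 0 = 1 := by simp [TS.levelNorm, h1]
    rw [h2, coeff_zero_eq_constantCoeff_apply, map_prod]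
    simp [expPS, ← coeff_zero_eq_constantCoeff_apply]
  · have hac := hgood.1 m
    have hint := hac.intervalIntegrable_deriv
    have key := levelNorm_integral_le (fun u => TS.mul (S u) (γ' u)) (S t) s t hst m
      (fun w => hS.1 t m w) (fun w => by
        rw [hS.2 t hst m w]
        simp [TS.one, hm1.ne']) _ hint ?_
    · rw [hac.integral_deriv_eq_sub] at key
      have := hV s le_rfl m
      simp only at key
      linarith
    · filter_upwards [hgood.2] with u hu hmem
      rw [(hu (by rw [Set.uIcc_of_le hst]; exact ⟨hmem.1.le, hmem.2⟩) m).deriv]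
      rw [coeff_h N m hm hm1 (fun k => TS.levelNorm (γ' u) k) _ (hγn u)]
      refine (levelNorm_mul_le _ _ _).trans (Finset.sum_le_sum fun k hk => ?_)
      rcases Nat.lt_or_ge k m with hkm | hkm
      · exact mul_le_mul_of_nonneg_right (ih k hkm (by omega) u hmem.1.le) (levelNorm_nonneg _ _)
      · simp [Nat.sub_eq_zero_of_le hkm, hγn]

end Helpers

/-- **Bell polynomial bound for the free development**: for componentwise absolutely continuous
`γ : [0,∞) → 𝒯_0` with derivative `γ'` and `t ≥ s ≥ 0`, for every `n ≥ 1`,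
`|π_n 𝒮(γ)_{s,t}| ≤ (1/n!) B_n(1! V_1, …, n! V_n)` with `V_k = ∫_s^t |π_k γ'(u)| du`. -/
theorem free_development_bell_bound (d : ℕ) (γ' : ℝ → TS d)
    (hγ0 : ∀ u w, γ' u 0 w = 0)
    (hγint : ∀ a b n w, IntervalIntegrable (fun u => γ' u n w) volume a b)
    (s t : ℝ) (hs : 0 ≤ s) (hst : s ≤ t)
    (S : ℝ → TS d) (hS : TS.IsDev γ' s S) :
    ∀ n : ℕ, 1 ≤ n →
      TS.levelNorm (S t) n ≤
        (1 / (n.factorial : ℝ)) *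
          bellPoly n (fun k => (k.factorial : ℝ) * ∫ u in s..t, TS.levelNorm (γ' u) k) := by
  intro n _
  rw [bell_eq n (fun k => ∫ u in s..t, TS.levelNorm (γ' u) k)]
  exact main_bound d γ' hγ0 hγint s S hS n n le_rfl t hst
end

section
/- Lipschitz estimate for free developments: let γ, β : [0,∞) → 𝒯_0 be componentwise absolutely continuous with ‖γ‖_{AC,1;[0,t]} < ∞ and ‖β‖_{AC,1;[0,t]} < ∞. Then for all s ∈ [0,t]: ‖𝒮(γ)_{s,t} − 𝒮(β)_{s,t}‖_1 ≤ ∫_s^t exp(‖γ‖_{AC,1;[s,u]} + ‖β‖_{AC,1;[u,t]}) · ‖γ̇(u) − β̇(u)‖_1 du ≤ exp(‖γ‖_{AC,1;[s,t]} + ‖β‖_{AC,1;[s,t]}) · ‖γ − β‖_{AC,1;[s,t]}. -/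
open scoped BigOperators ENNReal
open MeasureTheory

namespace FDL

open Set

noncomputable def prim (b : ℝ → ℝ≥0∞) (v : ℝ) : ℝ := ∫ x in (0:ℝ)..v, (b x).toReal

variable {b : ℝ → ℝ≥0∞}

lemma int_b (hb : Measurable b) (hfin : ∫⁻ x, b x ≠ ⊤) :
    Integrable (fun x => (b x).toReal) volume :=
  integrable_toReal_of_lintegral_ne_top hb.aemeasurable hfin

lemma prim_sub (hb : Measurable b) (hfin : ∫⁻ x, b x ≠ ⊤) {u v : ℝ} (huv : u ≤ v) :
    (∫⁻ x in Ioc u v, b x).toReal = prim b v - prim b u := by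
  have hi := int_b hb hfin
  have h1 : ∀ a c : ℝ, IntervalIntegrable (fun x => (b x).toReal) volume a c :=
    fun a c => hi.intervalIntegrable
  rw [prim, prim, intervalIntegral.integral_interval_sub_left (h1 _ _) (h1 _ _),
    intervalIntegral.integral_of_le huv, integral_toReal hb.aemeasurable]
  exact ae_restrict_of_ae (ae_lt_top hb hfin)

lemma prim_mono (hb : Measurable b) (hfin : ∫⁻ x, b x ≠ ⊤) : Monotone (prim b) := by
  intro u v huv
  have := prim_sub hb hfin huv
  have h2 : 0 ≤ (∫⁻ x in Ioc u v, b x).toReal := ENNReal.toReal_nonneg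
  linarith

lemma key (hb : Measurable b) (hfin : ∫⁻ x, b x ≠ ⊤) {u r : ℝ} (hur : u ≤ r) :
    1 + ∫⁻ v in Ioc u r, b v * ENNReal.ofReal (Real.exp (prim b v - prim b u)) ≤
      ENNReal.ofReal (Real.exp (prim b r - prim b u)) := by
  have hi := int_b hb hfin
  have hm := prim_mono hb hfin
  set f : ℝ → ℝ := fun v => Real.exp (prim b v - prim b u) with hf
  have hfm : Monotone f := fun x y hxy => Real.exp_le_exp.2 (by linarith [hm hxy])
  have hd : ∀ᵐ v, HasDerivAt f (f v * (b v).toReal) v := by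
    filter_upwards [LocallyIntegrable.ae_hasDerivAt_integral hi.locallyIntegrable] with v hv
    exact ((hv 0).sub_const (prim b u)).exp
  have hle := (hfm.monotoneOn (uIcc u r)).intervalIntegral_deriv_mem_uIcc
  have hii := (hfm.monotoneOn (uIcc u r)).intervalIntegrable_deriv
  have hle2 : ∫ v in u..r, deriv f v ≤ f r - f u := by
    rw [uIcc_of_le (by linarith [hfm hur])] at hle
    exact hle.2
  have hfu : f u = 1 := by simp [hf]
  rw [intervalIntegral.integral_of_le hur] at hle2
  have e1 : ∫⁻ v in Ioc u r, b v * ENNReal.ofReal (f v) =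
      ENNReal.ofReal (∫ v in Ioc u r, deriv f v) := by
    rw [ofReal_integral_eq_lintegral_ofReal]
    · apply lintegral_congr_ae
      apply ae_restrict_of_ae
      filter_upwards [hd, ae_lt_top hb hfin] with v hv hv2
      rw [hv.deriv, ENNReal.ofReal_mul (Real.exp_pos _).le, ENNReal.ofReal_toReal hv2.ne, mul_comm]
    · exact (intervalIntegrable_iff_integrableOn_Ioc_of_le hur).1 hii
    · exact Filter.Eventually.of_forall fun v => hfm.deriv_nonneg
  calc 1 + ∫⁻ v in Ioc u r, b v * ENNReal.ofReal (f v)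
      ≤ ENNReal.ofReal 1 + ENNReal.ofReal (f r - 1) := by
        rw [e1, ENNReal.ofReal_one]
        gcongr
        rw [← hfu]; exact hle2
    _ = ENNReal.ofReal (f r) := by
        rw [← ENNReal.ofReal_add zero_le_one]
        · congr 1; ring
        · linarith [hfm hur]

noncomputable def ker (b : ℝ → ℝ≥0∞) (u v : ℝ) : ℝ≥0∞ :=
  ENNReal.ofReal (Real.exp (prim b v - prim b u))

lemma ker_meas (hb : Measurable b) (hfin : ∫⁻ x, b x ≠ ⊤) :
    Measurable (Function.uncurry (ker b)) := by
  have hm := (prim_mono hb hfin).measurable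
  unfold ker Function.uncurry
  fun_prop

lemma duhamel (hb : Measurable b) (hfin : ∫⁻ x, b x ≠ ⊤) {k : ℝ → ℝ≥0∞} (hk : Measurable k)
    {s r : ℝ} :
    ∫⁻ v in Ioc s r, ((∫⁻ u in Ioc s v, ker b u v * k u) * b v + k v) ≤
      ∫⁻ u in Ioc s r, ker b u r * k u := by
  have hkm := ker_meas hb hfin
  rw [lintegral_add_right _ hk]
  have e1 : ∫⁻ v in Ioc s r, (∫⁻ u in Ioc s v, ker b u v * k u) * b v =
      ∫⁻ v in Ioc s r, ∫⁻ u in Ioc s r,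
        {p : ℝ × ℝ | p.2 ≤ p.1}.indicator (fun p => ker b p.2 p.1 * k p.2 * b p.1) (v, u) := by
    apply setLIntegral_congr_fun measurableSet_Ioc
    intro v hv
    have hm1 : Measurable fun u => ker b u v * k u :=
      (hkm.comp (measurable_id.prodMk measurable_const)).mul hk
    simp only
    rw [← lintegral_mul_const _ hm1]
    rw [← lintegral_indicator measurableSet_Ioc, ← lintegral_indicator measurableSet_Ioc]
    apply lintegral_congr
    intro u
    simp only [indicator, mem_Ioc, mem_ofPred_eq] at hv ⊢
    by_cases h1 : u ≤ v
    · have : u ≤ r := h1.trans hv.2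
      simp [h1, this]
    · simp [h1]
  rw [e1, lintegral_lintegral_swap]
  · rw [← lintegral_add_right _ hk]
    apply setLIntegral_mono' measurableSet_Ioc
    intro u hu
    have e2 : ∫⁻ v in Ioc s r, {p : ℝ × ℝ | p.2 ≤ p.1}.indicator
        (fun p => ker b p.2 p.1 * k p.2 * b p.1) (v, u) =
        k u * ∫⁻ v in Ioc u r, b v * ker b u v := by
      have hm1 : Measurable fun v => b v * ker b u v :=
        hb.mul (hkm.comp (measurable_const.prodMk measurable_id))
      rw [← lintegral_const_mul _ hm1, setLIntegral_congr (Ioc_ae_eq_Icc (a := u) (b := r))]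
      rw [← lintegral_indicator measurableSet_Ioc, ← lintegral_indicator measurableSet_Icc]
      apply lintegral_congr
      intro v
      simp only [indicator, mem_Ioc, mem_Icc, mem_ofPred_eq] at hu ⊢
      by_cases h1 : u ≤ v
      · have : s < v := hu.1.trans_le h1
        simp only [h1, this, true_and, if_true]
        split_ifs <;> ring
      · simp [h1]
    rw [e2]
    have := key hb hfin hu.2
    calc _ = (1 + ∫⁻ v in Ioc u r, b v * ker b u v) * k u := by ring
      _ ≤ _ := by gcongr; exact this
  · apply Measurable.aemeasurable
    apply Measurable.indicator
    · exact ((hkm.comp (measurable_snd.prodMk measurable_fst)).mul (hk.comp measurable_snd)).mul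
        (hb.comp measurable_fst)
    · exact measurableSet_le measurable_snd measurable_fst

variable {d : ℕ}

noncomputable def lv (n : ℕ) (x : TS d) : ℝ≥0∞ := ENNReal.ofReal (TS.levelNorm x n)

noncomputable def vec (n : ℕ) (x : TS d) : EuclideanSpace ℝ (Word d n) := WithLp.toLp 2 (x n)

lemma levelNorm_eq (n : ℕ) (x : TS d) : TS.levelNorm x n = ‖vec n x‖ := by
  simp [TS.levelNorm, vec, EuclideanSpace.norm_eq]

lemma lv_eq (n : ℕ) (x : TS d) : lv n x = ‖vec n x‖ₑ := by
  rw [lv, levelNorm_eq, ofReal_norm]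

lemma pNorm_one (x : TS d) : TS.pNorm 1 x = ∑' n, lv n x := by
  simp [TS.pNorm, lv]

lemma sum_split {k m n : ℕ} (hn : n = k + m) (f : Word d k → ℝ) (g : Word d m → ℝ)
    (h1 : ∀ i : Fin k, i.1 < n) (h2 : ∀ i : Fin m, k + i.1 < n) :
    ∑ w : Word d n, (f (fun i => w ⟨i.1, h1 i⟩) * g (fun i => w ⟨k + i.1, h2 i⟩)) ^ 2 =
      (∑ w, f w ^ 2) * ∑ w, g w ^ 2 := by
  subst hn
  rw [Finset.sum_mul_sum, ← Fintype.sum_prod_type', ← (Fin.appendEquiv k m).sum_comp]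
  apply Finset.sum_congr rfl
  rintro ⟨p, q⟩ -
  have e1 : (fun i : Fin k => Fin.appendEquiv k m (p, q) ⟨i.1, h1 i⟩) = p := by
    funext i
    exact Fin.append_left p q i
  have e2 : (fun i : Fin m => Fin.appendEquiv k m (p, q) ⟨k + i.1, h2 i⟩) = q := by
    funext i
    exact Fin.append_right p q i
  rw [e1, e2, mul_pow]

lemma lv_mul (n : ℕ) (x y : TS d) :
    lv n (TS.mul x y) ≤ ∑ k : Fin (n + 1), lv k.1 x * lv (n - k.1) y := by
  have e : vec n (TS.mul x y) = ∑ k : Fin (n + 1), (WithLp.toLp 2 (fun w : Word d n =>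
      x k.1 (fun i => w ⟨i.1, by have h1 := i.2; have h2 := k.2; omega⟩) *
      y (n - k.1) (fun i => w ⟨k.1 + i.1, by have h1 := i.2; have h2 := k.2; omega⟩)) :
      EuclideanSpace ℝ (Word d n)) := by
    ext w
    simp [vec, TS.mul]
  rw [lv_eq, e]
  refine (enorm_sum_le _ _).trans (Finset.sum_le_sum fun k _ => ?_)
  rw [lv, lv, ← ENNReal.ofReal_mul (show 0 ≤ TS.levelNorm x k.1 from Real.sqrt_nonneg _), ← ofReal_norm]
  apply le_of_eq
  congr 1
  rw [EuclideanSpace.norm_eq, TS.levelNorm, TS.levelNorm,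
    ← Real.sqrt_mul (Finset.sum_nonneg fun _ _ => sq_nonneg _)]
  congr 1
  simp only [Real.norm_eq_abs, sq_abs]
  exact sum_split (by have := k.2; omega) (x k.1) (y (n - k.1)) _ _

noncomputable def pt (N : ℕ) (x : TS d) : ℝ≥0∞ := ∑ n ∈ Finset.range N, lv n x

lemma pNorm_le (x : TS d) (C : ℝ≥0∞) (h : ∀ N, pt N x ≤ C) : TS.pNorm 1 x ≤ C := by
  rw [pNorm_one, ENNReal.tsum_eq_iSup_nat]
  exact iSup_le h

lemma pt_mul (N : ℕ) (x y : TS d) (hy : ∀ w, y 0 w = 0) :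
    pt (N + 1) (TS.mul x y) ≤ pt N x * TS.pNorm 1 y := by
  have hy0 : lv 0 y = 0 := by simp [lv, TS.levelNorm, hy]
  calc pt (N + 1) (TS.mul x y)
      ≤ ∑ n ∈ Finset.range (N + 1), ∑ k ∈ Finset.range N,
          if k < n then lv k x * lv (n - k) y else 0 := by
        apply Finset.sum_le_sum
        intro n hn
        refine (lv_mul n x y).trans ?_
        rw [Fin.sum_univ_eq_sum_range (fun k => lv k x * lv (n - k) y), Finset.sum_range_succ]
        simp only [Nat.sub_self, hy0, mul_zero, add_zero]
        rw [← Finset.sum_filter]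
        apply Finset.sum_le_sum_of_subset
        intro k hk
        simp only [Finset.mem_range, Finset.mem_filter] at *
        omega
    _ = ∑ k ∈ Finset.range N, lv k x *
          ∑ n ∈ (Finset.range (N + 1)).filter (fun n => k < n), lv (n - k) y := by
        rw [Finset.sum_comm]
        apply Finset.sum_congr rfl
        intro k _
        rw [← Finset.sum_filter, Finset.mul_sum]
    _ ≤ ∑ k ∈ Finset.range N, lv k x * TS.pNorm 1 y := by
        apply Finset.sum_le_sum
        intro k _
        gcongr
        rw [pNorm_one, ← Finset.sum_image (f := fun m => lv m y) (g := fun n => n - k)]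
        · exact ENNReal.sum_le_tsum _
        · intro i hi j hj hij
          simp only [Finset.coe_filter, Finset.mem_range, Set.mem_ofPred_eq] at *
          omega
    _ = _ := by rw [pt, Finset.sum_mul]

lemma vec_add {n : ℕ} {x y z : TS d} (h : ∀ w, x n w = y n w + z n w) :
    lv n x ≤ lv n y + lv n z := by
  have : vec n x = vec n y + vec n z := by
    ext w; simp [vec, h]
  rw [lv_eq, lv_eq, lv_eq, this]
  exact enorm_add_le _ _

lemma pt_add {N : ℕ} {x y z : TS d} (h : ∀ n w, x n w = y n w + z n w) :
    pt N x ≤ pt N y + pt N z := by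
  rw [pt, pt, pt, ← Finset.sum_add_distrib]
  exact Finset.sum_le_sum fun n _ => vec_add (h n)

lemma pt_integral (N : ℕ) (μ : Measure ℝ) (X : ℝ → TS d) (c Z : TS d)
    (hX : ∀ n w, Integrable (fun u => X u n w) μ)
    (hZ : ∀ n w, Z n w = c n w + ∫ u, X u n w ∂μ) :
    pt N Z ≤ pt N c + ∫⁻ u, pt N (X u) ∂μ := by
  have hI : ∀ n, Integrable (fun u => vec n (X u)) μ := fun n =>
    Integrable.of_eval_piLp (hX n)
  refine (pt_add (y := c) (z := fun n w => ∫ u, X u n w ∂μ) hZ).trans ?_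
  gcongr
  unfold pt
  rw [lintegral_finsetSum']
  · apply Finset.sum_le_sum
    intro n _
    have : vec n (fun n w => ∫ u, X u n w ∂μ) = ∫ u, vec n (X u) ∂μ := by
      ext w
      rw [eval_integral_piLp (hX n)]
      rfl
    simp only [lv_eq]
    rw [this]
    exact enorm_integral_le_lintegral_enorm _
  · intro n _
    simp only [lv_eq]
    exact (hI n).aestronglyMeasurable.enorm

lemma pNorm_meas {γ : ℝ → TS d} (h : ∀ n w, Measurable fun u => γ u n w) :
    Measurable fun u => TS.pNorm 1 (γ u) := by
  simp only [pNorm_one]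
  apply Measurable.tsum
  intro n
  unfold lv TS.levelNorm
  have := h n
  fun_prop

lemma pt_one_le (N : ℕ) : pt N (TS.one : TS d) ≤ 1 := by
  refine (ENNReal.sum_le_tsum _).trans ?_
  rw [tsum_eq_single 0]
  · simp [lv, TS.levelNorm, TS.one]
  · intro n hn
    simp [lv, TS.levelNorm, TS.one, hn]

lemma dev_bound {γ' : ℝ → TS d} (hγ0 : ∀ u w, γ' u 0 w = 0) {s t : ℝ}
    {S : ℝ → TS d} (hS : TS.IsDev γ' s S) {a : ℝ → ℝ≥0∞}
    (ha : Measurable a) (hfin : ∫⁻ x, a x ≠ ⊤)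
    (hae : ∀ u ∈ Ioc s t, TS.pNorm 1 (γ' u) = a u) (N : ℕ) :
    ∀ r ∈ Icc s t, pt N (S r) ≤ ker a s r := by
  induction N with
  | zero => intro r _; simp [pt]
  | succ N ih =>
    intro r hr
    have h1 := pt_integral (N + 1) (volume.restrict (Ioc s r)) (fun u => TS.mul (S u) (γ' u))
      TS.one (S r) (fun n w => (hS.1 r n w).1)
      (fun n w => by rw [hS.2 r hr.1, intervalIntegral.integral_of_le hr.1])
    refine h1.trans (le_trans ?_ (key ha hfin hr.1))
    gcongr ?_ + ?_
    · exact pt_one_le _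
    · apply setLIntegral_mono' measurableSet_Ioc
      intro u hu
      refine (pt_mul N _ _ (hγ0 u)).trans ?_
      rw [hae u ⟨hu.1, hu.2.trans hr.2⟩, mul_comm]
      gcongr
      exact ih u ⟨hu.1.le, hu.2.trans hr.2⟩

lemma diff_bound {γ' β' : ℝ → TS d} (hγ0 : ∀ u w, γ' u 0 w = 0) (hβ0 : ∀ u w, β' u 0 w = 0)
    {s t : ℝ} {S T : ℝ → TS d} (hS : TS.IsDev γ' s S) (hT : TS.IsDev β' s T)
    {a b c : ℝ → ℝ≥0∞}
    (ha : Measurable a) (hafin : ∫⁻ x, a x ≠ ⊤)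
    (hb : Measurable b) (hbfin : ∫⁻ x, b x ≠ ⊤) (hc : Measurable c)
    (hae : ∀ u ∈ Ioc s t, TS.pNorm 1 (γ' u) = a u)
    (hbe : ∀ u ∈ Ioc s t, TS.pNorm 1 (β' u) = b u)
    (hce : ∀ u, TS.pNorm 1 (TS.sub (γ' u) (β' u)) = c u) (N : ℕ) :
    ∀ r ∈ Icc s t, pt N (TS.sub (S r) (T r)) ≤
      ∫⁻ u in Ioc s r, ker b u r * (ker a s u * c u) := by
  have hk : Measurable fun u => ker a s u * c u :=
    ((ker_meas ha hafin).comp (measurable_const.prodMk measurable_id)).mul hc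
  induction N with
  | zero => intro r _; simp [pt]
  | succ N ih =>
    intro r hr
    have h1 := pt_integral (N + 1) (volume.restrict (Ioc s r))
      (fun u => TS.sub (TS.mul (S u) (γ' u)) (TS.mul (T u) (β' u)))
      TS.zero (TS.sub (S r) (T r)) (fun n w => (hS.1 r n w).1.sub (hT.1 r n w).1)
      (fun n w => by
        have := integral_sub (hS.1 r n w).1 (hT.1 r n w).1
        simp only [TS.sub, TS.zero]
        rw [this, hS.2 r hr.1, hT.2 r hr.1, intervalIntegral.integral_of_le hr.1,
          intervalIntegral.integral_of_le hr.1]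
        ring)
    have h0 : pt (N + 1) (TS.zero : TS d) = 0 := by
      simp [pt, lv, TS.levelNorm, TS.zero]
    rw [h0, zero_add] at h1
    refine h1.trans (le_trans ?_ (duhamel hb hbfin hk))
    apply setLIntegral_mono' measurableSet_Ioc
    intro u hu
    have hu' : u ∈ Ioc s t := ⟨hu.1, hu.2.trans hr.2⟩
    refine (pt_add (y := TS.mul (TS.sub (S u) (T u)) (β' u))
      (z := TS.mul (S u) (TS.sub (γ' u) (β' u))) ?_).trans ?_
    · intro n w
      simp only [TS.sub, TS.mul]
      rw [← Finset.sum_sub_distrib, ← Finset.sum_add_distrib]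
      apply Finset.sum_congr rfl
      intro k _
      ring
    · gcongr ?_ + ?_
      · refine (pt_mul N _ _ (hβ0 u)).trans ?_
        rw [hbe u hu']
        gcongr
        exact ih u (Ioc_subset_Icc_self hu')
      · refine (pt_mul N _ _ fun w => by simp [TS.sub, hγ0, hβ0]).trans ?_
        rw [hce]
        gcongr
        exact dev_bound hγ0 hS ha hafin hae N u (Ioc_subset_Icc_self hu')

end FDL

/-- **Lipschitz estimate for free developments**: for componentwise absolutely continuous
`γ, β : [0,∞) → 𝒯_0` with `‖γ‖_{AC,1;[0,t]} < ∞` and `‖β‖_{AC,1;[0,t]} < ∞` and all `s ∈ [0,t]`: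
`‖𝒮(γ)_{s,t} − 𝒮(β)_{s,t}‖_1 ≤ ∫_s^t e^{‖γ‖_{AC,1;[s,u]} + ‖β‖_{AC,1;[u,t]}} ‖γ'(u) − β'(u)‖_1 du
≤ e^{‖γ‖_{AC,1;[s,t]} + ‖β‖_{AC,1;[s,t]}} ‖γ − β‖_{AC,1;[s,t]}`. -/
theorem free_development_lipschitz (d : ℕ) (γ' β' : ℝ → TS d)
    (hγ0 : ∀ u w, γ' u 0 w = 0) (hβ0 : ∀ u w, β' u 0 w = 0)
    (hγmeas : ∀ n w, Measurable fun u => γ' u n w)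
    (hβmeas : ∀ n w, Measurable fun u => β' u n w)
    (hγint : ∀ a b n w, IntervalIntegrable (fun u => γ' u n w) volume a b)
    (hβint : ∀ a b n w, IntervalIntegrable (fun u => β' u n w) volume a b)
    (t : ℝ) (ht : 0 ≤ t)
    (hγfin : ∫⁻ u in Set.Ioc (0:ℝ) t, TS.pNorm 1 (γ' u) ≠ ⊤)
    (hβfin : ∫⁻ u in Set.Ioc (0:ℝ) t, TS.pNorm 1 (β' u) ≠ ⊤)
    (s : ℝ) (hs : 0 ≤ s) (hst : s ≤ t)
    (Sγ Sβ : ℝ → TS d)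
    (hSγ : TS.IsDev γ' s Sγ) (hSβ : TS.IsDev β' s Sβ) :
    TS.pNorm 1 (TS.sub (Sγ t) (Sβ t)) ≤
      (∫⁻ u in Set.Ioc s t,
        ENNReal.ofReal
            (Real.exp ((∫⁻ r in Set.Ioc s u, TS.pNorm 1 (γ' r)).toReal
              + (∫⁻ r in Set.Ioc u t, TS.pNorm 1 (β' r)).toReal)) *
          TS.pNorm 1 (TS.sub (γ' u) (β' u))) ∧
    (∫⁻ u in Set.Ioc s t,
        ENNReal.ofReal
            (Real.exp ((∫⁻ r in Set.Ioc s u, TS.pNorm 1 (γ' r)).toReal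
              + (∫⁻ r in Set.Ioc u t, TS.pNorm 1 (β' r)).toReal)) *
          TS.pNorm 1 (TS.sub (γ' u) (β' u))) ≤
      ENNReal.ofReal
          (Real.exp ((∫⁻ r in Set.Ioc s t, TS.pNorm 1 (γ' r)).toReal
            + (∫⁻ r in Set.Ioc s t, TS.pNorm 1 (β' r)).toReal)) *
        ∫⁻ u in Set.Ioc s t, TS.pNorm 1 (TS.sub (γ' u) (β' u)) := by
  have hγm := FDL.pNorm_meas hγmeas
  have hβm := FDL.pNorm_meas hβmeas
  have hcm : Measurable fun u => TS.pNorm 1 (TS.sub (γ' u) (β' u)) :=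
    FDL.pNorm_meas fun n w => (hγmeas n w).sub (hβmeas n w)
  have hsub : Set.Ioc s t ⊆ Set.Ioc 0 t := Set.Ioc_subset_Ioc_left hs
  have hγfin' : ∫⁻ u in Set.Ioc s t, TS.pNorm 1 (γ' u) ≠ ⊤ :=
    ne_top_of_le_ne_top hγfin (lintegral_mono_set hsub)
  have hβfin' : ∫⁻ u in Set.Ioc s t, TS.pNorm 1 (β' u) ≠ ⊤ :=
    ne_top_of_le_ne_top hβfin (lintegral_mono_set hsub)
  refine ⟨?_, ?_⟩
  · set a := (Set.Ioc s t).indicator fun u => TS.pNorm 1 (γ' u) with ha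
    set b := (Set.Ioc s t).indicator fun u => TS.pNorm 1 (β' u) with hb
    have ham : Measurable a := hγm.indicator measurableSet_Ioc
    have hbm : Measurable b := hβm.indicator measurableSet_Ioc
    have haf : ∫⁻ x, a x ≠ ⊤ := by rwa [ha, lintegral_indicator measurableSet_Ioc]
    have hbf : ∫⁻ x, b x ≠ ⊤ := by rwa [hb, lintegral_indicator measurableSet_Ioc]
    have hae : ∀ u ∈ Set.Ioc s t, TS.pNorm 1 (γ' u) = a u := fun u hu => by
      rw [ha, Set.indicator_of_mem hu]
    have hbe : ∀ u ∈ Set.Ioc s t, TS.pNorm 1 (β' u) = b u := fun u hu => by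
      rw [hb, Set.indicator_of_mem hu]
    apply FDL.pNorm_le
    intro N
    refine (FDL.diff_bound hγ0 hβ0 hSγ hSβ ham haf hbm hbf hcm hae hbe (fun _ => rfl) N t
      ⟨hst, le_rfl⟩).trans (le_of_eq ?_)
    apply setLIntegral_congr_fun measurableSet_Ioc
    intro u hu
    have e1 : ∫⁻ r in Set.Ioc s u, TS.pNorm 1 (γ' r) = ∫⁻ r in Set.Ioc s u, a r :=
      setLIntegral_congr_fun measurableSet_Ioc fun r hr => hae r ⟨hr.1, hr.2.trans hu.2⟩
    have e2 : ∫⁻ r in Set.Ioc u t, TS.pNorm 1 (β' r) = ∫⁻ r in Set.Ioc u t, b r :=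
      setLIntegral_congr_fun measurableSet_Ioc fun r hr => hbe r ⟨hu.1.trans hr.1, hr.2⟩
    simp only
    rw [e1, e2, FDL.prim_sub ham haf hu.1.le, FDL.prim_sub hbm hbf hu.2, Real.exp_add,
      ENNReal.ofReal_mul (Real.exp_pos _).le, FDL.ker, FDL.ker]
    ring
  · rw [← lintegral_const_mul _ hcm]
    apply setLIntegral_mono' measurableSet_Ioc
    intro u hu
    gcongr
    · exact hu.2
    · exact hu.1.le
end

section
/- Inner truncation estimate: let γ : [0,∞) → 𝒯_0 be componentwise absolutely continuous with ‖γ‖_{AC,1;[s,t]} < ∞ for some t ≥ s ≥ 0, and let N ∈ ℕ. Then ‖𝒮(γ)_{s,t} − 𝒮(π_{(0,N)} γ)_{s,t}‖_1 ≤ exp(‖γ‖_{AC,1;[s,t]}) · ‖γ − π_{(0,N)} γ‖_{AC,1;[s,t]}. -/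
open scoped BigOperators ENNReal
open MeasureTheory

lemma exp_neg_lip (a b : ℝ) (ha : 0 ≤ a) (hb : 0 ≤ b) :
    |Real.exp (-a) - Real.exp (-b)| ≤ |a - b| := by
  wlog h : a ≤ b generalizing a b
  · rw [abs_sub_comm, abs_sub_comm a]; exact this b a hb ha (by linarith)
  have h1 : Real.exp (-b) ≤ Real.exp (-a) := Real.exp_le_exp.2 (by linarith)
  rw [abs_of_nonneg (by linarith), abs_of_nonpos (by linarith : a - b ≤ 0)]
  have h2 : Real.exp (-b) = Real.exp (-a) * Real.exp (a - b) := by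
    rw [← Real.exp_add]; ring_nf
  have h3 := Real.add_one_le_exp (a - b)
  have h4 : Real.exp (-a) ≤ 1 := Real.exp_le_one_iff.2 (by linarith)
  have h5 := Real.exp_pos (-a)
  rw [h2]
  nlinarith

lemma ac_exp_neg {G : ℝ → ℝ} {a b : ℝ} (hG : AbsolutelyContinuousOnInterval G a b)
    (h0 : ∀ x ∈ Set.uIcc a b, 0 ≤ G x) :
    AbsolutelyContinuousOnInterval (fun x => Real.exp (-G x)) a b := by
  rw [absolutelyContinuousOnInterval_iff] at hG ⊢
  intro ε hε
  obtain ⟨δ, hδ, H⟩ := hG ε hε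
  refine ⟨δ, hδ, fun E hE hl => lt_of_le_of_lt ?_ (H E hE hl)⟩
  refine Finset.sum_le_sum fun i hi => ?_
  have := hE.1 i hi
  exact exp_neg_lip _ _ (h0 _ this.1) (h0 _ this.2)

lemma gron {s t c : ℝ} (hst : s ≤ t) {x y g h : ℝ → ℝ}
    (hg : IntervalIntegrable g volume s t) (hh : IntervalIntegrable h volume s t)
    (hy : IntervalIntegrable y volume s t) (hg0 : ∀ u, 0 ≤ g u)
    (hx : ∀ r ∈ Set.Icc s t, x r ≤ c + ∫ u in s..r, y u)
    (hyx : ∀ r ∈ Set.Icc s t, y r ≤ x r * g r + Real.exp (∫ u in s..r, g u) * h r) :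
    x t ≤ Real.exp (∫ u in s..t, g u) * (c + ∫ u in s..t, h u) := by
  have hmem : s ∈ Set.uIcc s t := Set.left_mem_uIcc
  set G : ℝ → ℝ := fun r => ∫ u in s..r, g u with hGdef
  set Φ : ℝ → ℝ := fun r => c + ∫ u in s..r, y u with hΦ
  have hGac : AbsolutelyContinuousOnInterval G s t :=
    hg.absolutelyContinuousOnInterval_intervalIntegral hmem
  have hΦac : AbsolutelyContinuousOnInterval Φ s t :=
    (LipschitzOnWith.absolutelyContinuousOnInterval (f := fun _ => c) (K := 0)
      (LipschitzWith.const c).lipschitzOnWith).add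
    (hy.absolutelyContinuousOnInterval_intervalIntegral hmem)
  have hEac := ac_exp_neg hGac (fun r hr => by
    rw [Set.uIcc_of_le hst] at hr
    exact intervalIntegral.integral_nonneg hr.1 (fun u _ => hg0 u))
  have hP := hEac.mul hΦac
  have hftc := hP.integral_deriv_eq_sub
  have hle : ∫ u in s..t, deriv ((fun x => Real.exp (-G x)) * Φ) u ≤ ∫ u in s..t, h u := by
    refine intervalIntegral.integral_mono_ae_restrict hst hP.intervalIntegrable_deriv hh ?_
    rw [Filter.EventuallyLE, ae_restrict_iff' measurableSet_Icc]
    filter_upwards [hg.ae_hasDerivAt_integral, hy.ae_hasDerivAt_integral] with u h1 h2 hu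
    have hu' : u ∈ Set.uIcc s t := by rwa [Set.uIcc_of_le hst]
    have d1 : HasDerivAt G (g u) u := h1 hu' s hmem
    have d2 : HasDerivAt Φ (y u) u := (h2 hu' s hmem).const_add c
    have d3 := (d1.neg.exp).mul d2
    have e3 : deriv ((fun x => Real.exp (-G x)) * Φ) u = _ := d3.deriv
    rw [e3]
    have a1 := hx u hu
    have a2 := hyx u hu
    have a3 : x u * g u ≤ Φ u * g u := mul_le_mul_of_nonneg_right a1 (hg0 u)
    have a4 : y u ≤ Φ u * g u + Real.exp (G u) * h u := a2.trans (by simpa [hGdef] using a3)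
    have a5 := mul_le_mul_of_nonneg_left a4 (Real.exp_pos (-G u)).le
    have a6 : Real.exp (-G u) * Real.exp (G u) = 1 := by rw [← Real.exp_add]; simp
    have a7 : Real.exp (-G u) * (Real.exp (G u) * h u) = h u := by rw [← mul_assoc, a6, one_mul]
    simp only [Pi.neg_apply]
    nlinarith
  rw [hftc] at hle
  have hs1 : G s = 0 := by simp [hGdef]
  have hs2 : Φ s = c := by simp [hΦ]
  simp only [Pi.mul_apply, hs1, hs2, neg_zero, Real.exp_zero, one_mul] at hle
  have b1 := hx t ⟨hst, le_rfl⟩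
  have b2 : Real.exp (G t) * Real.exp (-G t) = 1 := by rw [← Real.exp_add]; simp
  have b3 := mul_le_mul_of_nonneg_left (show Real.exp (-G t) * Φ t ≤ c + ∫ u in s..t, h u by linarith) (Real.exp_pos (G t)).le
  rw [← mul_assoc, b2, one_mul] at b3
  exact b1.trans b3

namespace TS

variable {d : ℕ}

lemma levelNorm_eq (x : TS d) (n : ℕ) :
    levelNorm x n = ‖(WithLp.toLp 2 (x n) : EuclideanSpace ℝ (Word d n))‖ := by
  rw [EuclideanSpace.norm_eq]
  simp [levelNorm]

lemma levelNorm_nonneg (x : TS d) (n : ℕ) : 0 ≤ levelNorm x n := Real.sqrt_nonneg _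

lemma levelNorm_add (x y : TS d) (n : ℕ) :
    levelNorm (add x y) n ≤ levelNorm x n + levelNorm y n := by
  simp only [levelNorm_eq]
  exact norm_add_le (WithLp.toLp 2 (x n) : EuclideanSpace ℝ (Word d n)) (WithLp.toLp 2 (y n))

lemma sum_word_mul {k m n : ℕ} (h : k + m = n) (a : Word d k → ℝ) (b : Word d m → ℝ) :
    ∑ w : Word d n, (a (fun i => w ⟨i.1, by have h1 := i.2; omega⟩) *
      b (fun i => w ⟨k + i.1, by have h1 := i.2; omega⟩)) ^ 2 =
    (∑ u, a u ^ 2) * ∑ v, b v ^ 2 := by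
  subst h
  rw [Finset.sum_mul_sum, ← Fintype.sum_prod_type']
  refine Fintype.sum_equiv (Fin.appendEquiv k m).symm _ _ fun w => ?_
  rw [mul_pow]
  rfl

lemma levelNorm_mul (x y : TS d) (n : ℕ) :
    levelNorm (mul x y) n ≤ ∑ k ∈ Finset.range (n + 1), levelNorm x k * levelNorm y (n - k) := by
  rw [Finset.sum_range (fun k => levelNorm x k * levelNorm y (n - k)), levelNorm_eq]
  have e : (WithLp.toLp 2 (mul x y n) : EuclideanSpace ℝ (Word d n)) =
      ∑ k : Fin (n + 1), WithLp.toLp 2 (fun w : Word d n =>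
        x k.1 (fun i => w ⟨i.1, by have h1 := i.2; have h2 := k.2; omega⟩) *
      y (n - k.1) (fun i => w ⟨k.1 + i.1, by have h1 := i.2; have h2 := k.2; omega⟩)) := by
    ext w
    simp [mul]
  rw [e]
  refine (norm_sum_le _ _).trans (Finset.sum_le_sum fun k _ => le_of_eq ?_)
  rw [EuclideanSpace.norm_eq, levelNorm, levelNorm, ← Real.sqrt_mul (by positivity)]
  have hk := k.2
  rw [← sum_word_mul (show k.1 + (n - k.1) = n by omega)]
  simp only [Real.norm_eq_abs, sq_abs]

/-- Partial sums of the level norms. -/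
noncomputable def T (M : ℕ) (x : TS d) : ℝ := ∑ n ∈ Finset.range M, levelNorm x n

lemma T_nonneg (M : ℕ) (x : TS d) : 0 ≤ T M x :=
  Finset.sum_nonneg fun _ _ => levelNorm_nonneg _ _

lemma T_add (M : ℕ) (x y : TS d) : T M (add x y) ≤ T M x + T M y := by
  rw [T, T, T, ← Finset.sum_add_distrib]
  exact Finset.sum_le_sum fun n _ => levelNorm_add x y n

lemma T_mul (M : ℕ) (x y : TS d) : T M (mul x y) ≤ T M x * T M y := by
  calc T M (mul x y)
      ≤ ∑ n ∈ Finset.range M, ∑ k ∈ Finset.range (n + 1), levelNorm x k * levelNorm y (n - k) :=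
        Finset.sum_le_sum fun n _ => levelNorm_mul x y n
    _ = ∑ m ∈ Finset.range M, ∑ k ∈ Finset.range (M - m), levelNorm x m * levelNorm y k :=
        Finset.sum_range_diag_flip M fun k m => levelNorm x k * levelNorm y m
    _ ≤ ∑ m ∈ Finset.range M, ∑ k ∈ Finset.range M, levelNorm x m * levelNorm y k := by
        refine Finset.sum_le_sum fun m _ => Finset.sum_le_sum_of_subset_of_nonneg ?_ ?_
        · intro k hk
          simp only [Finset.mem_range] at hk ⊢
          omega
        · intro k _ _
          exact mul_nonneg (levelNorm_nonneg _ _) (levelNorm_nonneg _ _)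
    _ = T M x * T M y := by rw [T, T, Finset.sum_mul_sum]

lemma T_truncate (M N : ℕ) (x : TS d) : T M (truncate N x) ≤ T M x := by
  refine Finset.sum_le_sum fun n _ => ?_
  rw [levelNorm, levelNorm]
  refine Real.sqrt_le_sqrt (Finset.sum_le_sum fun w _ => ?_)
  unfold truncate
  split_ifs
  · exact le_rfl
  · simpa using sq_nonneg _

lemma T_one (M : ℕ) : T M (one : TS d) ≤ 1 := by
  have h : ∀ n, levelNorm (one : TS d) n = if n = 0 then 1 else 0 := by
    intro n
    unfold levelNorm one
    split_ifs with h
    · subst h; simp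
    · simp
  simp only [T, h]
  rw [Finset.sum_ite_eq']
  split_ifs <;> simp

lemma pNorm_one (x : TS d) : pNorm 1 x = ∑' n : ℕ, ENNReal.ofReal (levelNorm x n) := by
  simp [pNorm]

lemma ofReal_T (M : ℕ) (x : TS d) :
    ENNReal.ofReal (T M x) = ∑ n ∈ Finset.range M, ENNReal.ofReal (levelNorm x n) :=
  ENNReal.ofReal_sum_of_nonneg fun _ _ => levelNorm_nonneg _ _

lemma T_le_pNorm (M : ℕ) (x : TS d) : ENNReal.ofReal (T M x) ≤ pNorm 1 x := by
  rw [ofReal_T, pNorm_one]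
  exact ENNReal.sum_le_tsum _

lemma pNorm_le (x : TS d) (C : ℝ≥0∞) (h : ∀ M, ENNReal.ofReal (T M x) ≤ C) : pNorm 1 x ≤ C := by
  rw [pNorm_one, ENNReal.tsum_eq_iSup_nat]
  exact iSup_le fun M => by rw [← ofReal_T]; exact h M

lemma vec_integrable {F : ℝ → TS d} {s r : ℝ} (n : ℕ)
    (hF : ∀ w, IntervalIntegrable (fun u => F u n w) volume s r) :
    IntervalIntegrable (fun u => (WithLp.toLp 2 (F u n) : EuclideanSpace ℝ (Word d n)))
      volume s r :=
  ⟨Integrable.of_eval_piLp fun w => (hF w).1, Integrable.of_eval_piLp fun w => (hF w).2⟩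

lemma T_integrable {F : ℝ → TS d} {s r : ℝ} (M : ℕ)
    (hF : ∀ n w, IntervalIntegrable (fun u => F u n w) volume s r) :
    IntervalIntegrable (fun u => T M (F u)) volume s r := by
  have := IntervalIntegrable.sum (Finset.range M) (μ := volume) (a := s) (b := r)
    (f := fun n u => levelNorm (F u) n) (fun n _ => by
      simp only [levelNorm_eq]
      exact (vec_integrable n (hF n)).norm)
  have e : (fun u => T M (F u)) = ∑ n ∈ Finset.range M, fun u => levelNorm (F u) n := by
    funext u
    simp [T]
  rw [e]
  exact this

lemma T_integral_le {F : ℝ → TS d} {s r : ℝ} (hsr : s ≤ r) (M : ℕ)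
    (hF : ∀ n w, IntervalIntegrable (fun u => F u n w) volume s r) :
    T M (fun n w => ∫ u in s..r, F u n w) ≤ ∫ u in s..r, T M (F u) := by
  unfold T
  rw [intervalIntegral.integral_finsetSum (fun n _ => by
      simp only [levelNorm_eq]
      exact (vec_integrable n (hF n)).norm)]
  refine Finset.sum_le_sum fun n _ => ?_
  simp only [levelNorm_eq]
  have e : (WithLp.toLp 2 (fun w => ∫ u in s..r, F u n w) : EuclideanSpace ℝ (Word d n)) =
      ∫ u in s..r, (WithLp.toLp 2 (F u n) : EuclideanSpace ℝ (Word d n)) := by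
    ext w
    rw [intervalIntegral.integral_of_le hsr, eval_integral_piLp
      (f := fun u => (WithLp.toLp 2 (F u n) : EuclideanSpace ℝ (Word d n))) fun w => (hF n w).1]
    simp [intervalIntegral.integral_of_le hsr]
  rw [e]
  exact intervalIntegral.norm_integral_le_integral_norm hsr

lemma mul_sub_mul (x y a b : TS d) :
    sub (mul x a) (mul y b) = add (mul (sub x y) b) (mul x (sub a b)) := by
  funext n w
  simp only [sub, add, mul]
  rw [← Finset.sum_sub_distrib, ← Finset.sum_add_distrib]
  exact Finset.sum_congr rfl fun k _ => by ring

lemma dev_bound {γ' : ℝ → TS d} {s : ℝ} {S : ℝ → TS d} (hS : IsDev γ' s S)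
    (hγint : ∀ a b n w, IntervalIntegrable (fun u => γ' u n w) volume a b)
    (M : ℕ) (r : ℝ) (hr : s ≤ r) :
    T M (S r) ≤ Real.exp (∫ u in s..r, T M (γ' u)) := by
  have := gron (c := 1) (x := fun u => T M (S u)) (y := fun u => T M (mul (S u) (γ' u)))
    (g := fun u => T M (γ' u)) (h := fun _ => 0) hr (T_integrable M (hγint s r)) (by simp)
    (T_integrable M (hS.1 r)) (fun u => T_nonneg _ _) ?_ ?_
  · simpa using this
  · intro q hq
    have e : S q = add one (fun n w => ∫ u in s..q, mul (S u) (γ' u) n w) := by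
      funext n w; exact hS.2 q hq.1 n w
    show T M (S q) ≤ _
    rw [e]
    exact (T_add _ _ _).trans (add_le_add (T_one M) (T_integral_le hq.1 M (hS.1 q)))
  · intro q _
    simpa using T_mul M (S q) (γ' q)

end TS

/-- **Inner truncation estimate**: for componentwise absolutely continuous `γ : [0,∞) → 𝒯_0`
with `‖γ‖_{AC,1;[s,t]} < ∞` and any truncation level `N`,
`‖𝒮(γ)_{s,t} − 𝒮(π_{(0,N)} γ)_{s,t}‖_1 ≤ e^{‖γ‖_{AC,1;[s,t]}} ‖γ − π_{(0,N)} γ‖_{AC,1;[s,t]}`. -/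
theorem free_development_inner_truncation (d : ℕ) (γ' : ℝ → TS d)
    (hγ0 : ∀ u w, γ' u 0 w = 0)
    (hγmeas : ∀ n w, Measurable fun u => γ' u n w)
    (hγint : ∀ a b n w, IntervalIntegrable (fun u => γ' u n w) volume a b)
    (s t : ℝ) (hs : 0 ≤ s) (hst : s ≤ t)
    (hfin : ∫⁻ u in Set.Ioc s t, TS.pNorm 1 (γ' u) ≠ ⊤)
    (N : ℕ) (S SN : ℝ → TS d)
    (hS : TS.IsDev γ' s S)
    (hSN : TS.IsDev (fun u => TS.truncate N (γ' u)) s SN) :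
    TS.pNorm 1 (TS.sub (S t) (SN t)) ≤
      ENNReal.ofReal (Real.exp (∫⁻ u in Set.Ioc s t, TS.pNorm 1 (γ' u)).toReal) *
        ∫⁻ u in Set.Ioc s t, TS.pNorm 1 (TS.sub (γ' u) (TS.truncate N (γ' u))) := by
  
  have htr : ∀ a b n w, IntervalIntegrable (fun u => TS.truncate N (γ' u) n w) volume a b := by
    intro a b n w
    unfold TS.truncate
    split_ifs
    · exact hγint a b n w
    · simp
  have hdf : ∀ a b n w, IntervalIntegrable
      (fun u => TS.sub (γ' u) (TS.truncate N (γ' u)) n w) volume a b :=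
    fun a b n w => (hγint a b n w).sub (htr a b n w)
  have key : ∀ {F : ℝ → TS d} (M : ℕ),
      (∀ a b n w, IntervalIntegrable (fun u => F u n w) volume a b) →
      ENNReal.ofReal (∫ u in s..t, TS.T M (F u)) ≤ ∫⁻ u in Set.Ioc s t, TS.pNorm 1 (F u) := by
    intro F M hF
    rw [intervalIntegral.integral_of_le hst,
      ofReal_integral_eq_lintegral_ofReal (TS.T_integrable M (hF s t)).1
        (Filter.Eventually.of_forall fun u => TS.T_nonneg _ _)]
    exact lintegral_mono fun u => TS.T_le_pNorm M _
  refine TS.pNorm_le _ _ fun M => ?_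
  have hdi : ∀ r n w, IntervalIntegrable (fun u => TS.sub (TS.mul (S u) (γ' u))
      (TS.mul (SN u) (TS.truncate N (γ' u))) n w) volume s r :=
    fun r n w => (hS.1 r n w).sub (hSN.1 r n w)
  have main := gron (c := 0) (x := fun u => TS.T M (TS.sub (S u) (SN u)))
    (y := fun u => TS.T M (TS.sub (TS.mul (S u) (γ' u)) (TS.mul (SN u) (TS.truncate N (γ' u)))))
    (g := fun u => TS.T M (γ' u))
    (h := fun u => TS.T M (TS.sub (γ' u) (TS.truncate N (γ' u)))) hst
    (TS.T_integrable M (hγint s t)) (TS.T_integrable M (hdf s t))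
    (TS.T_integrable M (hdi t)) (fun u => TS.T_nonneg _ _) ?_ ?_
  · refine (ENNReal.ofReal_le_ofReal main).trans ?_
    rw [zero_add, ENNReal.ofReal_mul (Real.exp_pos _).le]
    refine mul_le_mul' (ENNReal.ofReal_le_ofReal (Real.exp_le_exp.2 ?_)) (key M hdf)
    exact (ENNReal.ofReal_le_iff_le_toReal hfin).1 (key M hγint)
  · intro r hr
    have e : TS.sub (S r) (SN r) = fun n w => ∫ u in s..r, TS.sub (TS.mul (S u) (γ' u))
        (TS.mul (SN u) (TS.truncate N (γ' u))) n w := by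
      funext n w
      simp only [TS.sub]
      rw [intervalIntegral.integral_sub (hS.1 r n w) (hSN.1 r n w), hS.2 r hr.1 n w,
        hSN.2 r hr.1 n w]
      ring
    show TS.T M (TS.sub (S r) (SN r)) ≤ _
    rw [e, zero_add]
    exact TS.T_integral_le hr.1 M (hdi r)
  · intro r hr
    show TS.T M (TS.sub (TS.mul (S r) (γ' r)) (TS.mul (SN r) (TS.truncate N (γ' r)))) ≤ _
    rw [TS.mul_sub_mul]
    refine (TS.T_add _ _ _).trans (add_le_add ?_ ?_)
    · exact (TS.T_mul _ _ _).trans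
        (mul_le_mul_of_nonneg_left (TS.T_truncate _ _ _) (TS.T_nonneg _ _))
    · exact (TS.T_mul _ _ _).trans
        (mul_le_mul_of_nonneg_right (TS.dev_bound hS hγint M r hr.1) (TS.T_nonneg _ _))
end

section
/- Outer truncation (factorial) estimate: let γ : [0,∞) → 𝒯_0 be componentwise absolutely continuous with ‖γ‖_{AC,1;[0,t]} < ∞ for some t ≥ 0, and let M, N ∈ ℕ with M ≥ N ≥ 1. Then, writing L := ‖π_{(0,N)} γ‖_{AC,1;[0,t]} and K := ⌈M/N⌉, it holds ‖𝒮(π_{(0,N)} γ)_{0,t} − π_{(0,M−1)} 𝒮(π_{(0,N)} γ)_{0,t}‖_1 ≤ e^L · L^K / K!. -/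
open scoped BigOperators ENNReal
open MeasureTheory

namespace TSaux

lemma pow_lint (h : ℝ → ℝ) (h0 : ∀ u, 0 ≤ h u) (t : ℝ) (ht : 0 ≤ t)
    (hi : IntervalIntegrable h volume 0 t) (j : ℕ) :
    ∫⁻ u in Set.Ioc 0 t, ENNReal.ofReal ((∫ v in (0:ℝ)..u, h v) ^ j / (j.factorial : ℝ)) * ENNReal.ofReal (h u)
      = ENNReal.ofReal ((∫ v in (0:ℝ)..t, h v) ^ (j+1) / ((j+1).factorial : ℝ)) := by
  set L : ℝ → ℝ := fun u => ∫ v in (0:ℝ)..u, h v with hL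
  have hac : AbsolutelyContinuousOnInterval L 0 t :=
    hi.absolutelyContinuousOnInterval_intervalIntegral (c := 0) (by simp)
  have hacp : ∀ k : ℕ, AbsolutelyContinuousOnInterval (fun u => L u ^ (k+1)) 0 t := by
    intro k
    induction k with
    | zero => simpa using hac
    | succ k ih =>
      have := ih.fun_mul hac
      simpa [pow_succ] using this
  have hL0 : ∀ u, 0 ≤ u → 0 ≤ L u := fun u hu =>
    intervalIntegral.integral_nonneg hu (fun v _ => h0 v)
  have hd := hi.ae_hasDerivAt_integral
  have key : ∫ u in (0:ℝ)..t, ((j:ℝ)+1) * (L u ^ j * h u) = L t ^ (j+1) := by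
    have := (hacp j).integral_deriv_eq_sub
    have hL00 : L 0 = 0 := by simp [hL]
    rw [hL00] at this
    simp only [ne_eq, Nat.add_eq_zero_iff, one_ne_zero, and_false, not_false_eq_true, zero_pow, sub_zero] at this
    rw [← this]
    apply intervalIntegral.integral_congr_ae
    filter_upwards [hd] with x hx hx'
    have h1 := (hx (Set.uIoc_subset_uIcc hx') 0 (by simp)).pow (j+1)
    have h2 : HasDerivAt (fun u => L u ^ (j+1)) (((j+1 : ℕ):ℝ) * L x ^ (j + 1 - 1) * h x) x := h1
    rw [h2.deriv]
    push_cast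
    ring
  rw [intervalIntegral.integral_const_mul] at key
  have hint : IntervalIntegrable (fun u => L u ^ j / (j.factorial:ℝ) * h u) volume 0 t := by
    apply hi.continuousOn_mul
    exact (hac.continuousOn.pow j).div_const _
  have e1 : ∫⁻ u in Set.Ioc 0 t, ENNReal.ofReal (L u ^ j / (j.factorial : ℝ)) * ENNReal.ofReal (h u)
      = ∫⁻ u in Set.Ioc 0 t, ENNReal.ofReal (L u ^ j / (j.factorial : ℝ) * h u) := by
    apply setLIntegral_congr_fun measurableSet_Ioc
    intro u hu
    have := hL0 u hu.1.le
    exact (ENNReal.ofReal_mul (by positivity)).symm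
  rw [e1, ← ofReal_integral_eq_lintegral_ofReal]
  · rw [← intervalIntegral.integral_of_le ht]
    congr 1
    have : ∀ u, L u ^ j / (j.factorial : ℝ) * h u = (j.factorial:ℝ)⁻¹ * (L u ^ j * h u) := by
      intro u; ring
    simp_rw [this]
    rw [intervalIntegral.integral_const_mul]
    change _ = L t ^ (j+1) / _
    rw [← key, Nat.factorial_succ]
    push_cast
    have : (j.factorial:ℝ) ≠ 0 := by positivity
    have : (j:ℝ)+1 ≠ 0 := by positivity
    field_simp
  · exact (intervalIntegrable_iff_integrableOn_Ioc_of_le ht).1 hint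
  · rw [Filter.EventuallyLE, ae_restrict_iff' measurableSet_Ioc]
    refine Filter.Eventually.of_forall fun u hu => ?_
    have := hL0 u hu.1.le
    have := h0 u
    simp only [Pi.zero_apply]
    positivity

lemma tsum_anti (a b : ℕ → ℝ≥0∞) :
    ∑' n, ∑ p ∈ Finset.HasAntidiagonal.antidiagonal n, a p.1 * b p.2 = (∑' n, a n) * ∑' n, b n := by
  have : (∑' n, a n) * ∑' n, b n = ∑' p : ℕ × ℕ, a p.1 * b p.2 := by
    rw [ENNReal.tsum_prod', ← ENNReal.tsum_mul_right]
    simp_rw [ENNReal.tsum_mul_left]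
  rw [this, ← Finset.HasAntidiagonal.sigmaAntidiagonalEquivProd.tsum_eq, ENNReal.tsum_sigma']
  congr 1
  ext n
  rw [← Finset.sum_coe_sort, tsum_fintype]
  rfl

lemma anti_le (a b : ℕ → ℝ≥0∞) (A B : ℕ → Prop) [DecidablePred A] [DecidablePred B]
    (hAB : ∀ i j, b j ≠ 0 → A (i + j) → B i) :
    ∑' n, (if A n then ∑ p ∈ Finset.HasAntidiagonal.antidiagonal n, a p.1 * b p.2 else 0)
      ≤ (∑' n, if B n then a n else 0) * ∑' n, b n := by
  rw [← tsum_anti]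
  apply ENNReal.tsum_le_tsum
  intro n
  split_ifs with h
  · apply Finset.sum_le_sum
    intro p hp
    rw [Finset.HasAntidiagonal.mem_antidiagonal] at hp
    by_cases hb : b p.2 = 0
    · simp [hb]
    · rw [if_pos (hAB p.1 p.2 hb (hp ▸ h))]
  · simp

section core
variable (F H : ℕ → ℝ → ℝ≥0∞) (h : ℝ → ℝ) (N : ℕ) (T : ℝ)

lemma step (hH : ∀ u, ∑' n, H n u = ENNReal.ofReal (h u))
    (hFm : ∀ n, AEMeasurable (F n) (volume.restrict (Set.Ioc 0 T)))
    (hHm : ∀ n, Measurable (H n))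
    (hF : ∀ s, 0 ≤ s → s ≤ T → ∀ n, F n s ≤ (if n = 0 then 1 else 0) +
      ∫⁻ u in Set.Ioc 0 s, ∑ p ∈ Finset.HasAntidiagonal.antidiagonal n, F p.1 u * H p.2 u)
    (A B : ℕ → Prop) [DecidablePred A] [DecidablePred B]
    (hAB : ∀ i j u, H j u ≠ 0 → A (i + j) → B i) (s : ℝ) (hs0 : 0 ≤ s) (hsT : s ≤ T) :
    (∑' n, if A n then F n s else 0) ≤ (if A 0 then 1 else 0) +
      ∫⁻ u in Set.Ioc 0 s, (∑' n, if B n then F n u else 0) * ENNReal.ofReal (h u) := by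
  have hle : volume.restrict (Set.Ioc 0 s) ≤ volume.restrict (Set.Ioc 0 T) :=
    Measure.restrict_mono (Set.Ioc_subset_Ioc_right hsT) le_rfl
  have hm : ∀ n, AEMeasurable (fun u => if A n then ∑ p ∈ Finset.HasAntidiagonal.antidiagonal n, F p.1 u * H p.2 u else 0)
      (volume.restrict (Set.Ioc 0 s)) := by
    intro n
    split_ifs
    · apply Finset.aemeasurable_fun_sum
      intro p _
      exact ((hFm p.1).mono_measure hle).mul (hHm p.2).aemeasurable
    · exact aemeasurable_const
  calc (∑' n, if A n then F n s else 0)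
      ≤ ∑' n, ((if n = 0 then (if A 0 then 1 else 0) else 0) +
        ∫⁻ u in Set.Ioc 0 s, if A n then ∑ p ∈ Finset.HasAntidiagonal.antidiagonal n, F p.1 u * H p.2 u else 0) := by
        apply ENNReal.tsum_le_tsum
        intro n
        split_ifs with h1 h2 h3 h3
        · simpa [h2] using hF s hs0 hsT n
        · exact absurd (h2 ▸ h1) h3
        · simpa [h2] using hF s hs0 hsT n
        all_goals simp
    _ = (if A 0 then 1 else 0) + ∫⁻ u in Set.Ioc 0 s, ∑' n,
        (if A n then ∑ p ∈ Finset.HasAntidiagonal.antidiagonal n, F p.1 u * H p.2 u else 0) := by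
        rw [ENNReal.tsum_add, lintegral_tsum hm, tsum_ite_eq]
    _ ≤ _ := by
        gcongr with u
        rw [← hH u]
        exact anti_le (fun n => F n u) (fun n => H n u) A B (fun i j hj hA => hAB i j u hj hA)

theorem core (hN : 1 ≤ N) (h0 : ∀ u, 0 ≤ h u) 
    (hi : IntervalIntegrable h volume 0 T)
    (hH : ∀ u, ∑' n, H n u = ENNReal.ofReal (h u))
    (hFm : ∀ n, AEMeasurable (F n) (volume.restrict (Set.Ioc 0 T)))
    (hHm : ∀ n, Measurable (H n))
    (hH0 : ∀ u, H 0 u = 0) (hHN : ∀ n u, N < n → H n u = 0)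
    (hF : ∀ s, 0 ≤ s → s ≤ T → ∀ n, F n s ≤ (if n = 0 then 1 else 0) +
      ∫⁻ u in Set.Ioc 0 s, ∑ p ∈ Finset.HasAntidiagonal.antidiagonal n, F p.1 u * H p.2 u)
    (K : ℕ) : ∀ m, (K = 0 ∨ (K - 1) * N < m) → ∀ s, 0 ≤ s → s ≤ T →
    (∑' n, if m ≤ n then F n s else 0) ≤ ENNReal.ofReal (Real.exp (∫ v in (0:ℝ)..s, h v) *
      ((∫ v in (0:ℝ)..s, h v) ^ K / (K.factorial : ℝ))) := by
  have hL0 : ∀ u, 0 ≤ u → 0 ≤ ∫ v in (0:ℝ)..u, h v := fun u hu =>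
    intervalIntegral.integral_nonneg hu (fun v _ => h0 v)
  have hi' : ∀ s, 0 ≤ s → s ≤ T → IntervalIntegrable h volume 0 s := by
    intro s h1 h2
    apply hi.mono_set
    rw [Set.uIcc_of_le h1, Set.uIcc_of_le (h1.trans h2)]
    exact Set.Icc_subset_Icc_right h2
  have hLm : ∀ s, 0 ≤ s → s ≤ T → ∀ u, 0 ≤ u → u ≤ s →
      (∫ v in (0:ℝ)..u, h v) ≤ ∫ v in (0:ℝ)..s, h v := by
    intro s h1 h2 u h3 h4
    exact intervalIntegral.integral_mono_interval le_rfl h3 h4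
      (Filter.Eventually.of_forall h0) (hi' s h1 h2)
  have hLmeas : ∀ s, 0 ≤ s → s ≤ T → ∀ j : ℕ, AEMeasurable
      (fun u => ENNReal.ofReal ((∫ v in (0:ℝ)..u, h v) ^ j / (j.factorial : ℝ)) * ENNReal.ofReal (h u))
        (volume.restrict (Set.Ioc 0 s)) := by
    intro s h1 h2 j
    have hac := (hi' s h1 h2).absolutelyContinuousOnInterval_intervalIntegral (c := 0) (by simp)
    have hc := hac.continuousOn
    rw [Set.uIcc_of_le h1] at hc
    have := (hc.mono Set.Ioc_subset_Icc_self).aemeasurable (μ := volume) measurableSet_Ioc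
    have h3 := ((intervalIntegrable_iff_integrableOn_Ioc_of_le h1).1 (hi' s h1 h2)).aemeasurable
    exact ((this.pow_const j).div_const _).ennreal_ofReal.mul h3.ennreal_ofReal
  -- finite partial sums
  have hP : ∀ p : ℕ, ∀ s, 0 ≤ s → s ≤ T → (∑' n, if n < p then F n s else 0) ≤
      ∑ j ∈ Finset.range p, ENNReal.ofReal ((∫ v in (0:ℝ)..s, h v) ^ j / (j.factorial : ℝ)) := by
    intro p
    induction p with
    | zero => intro s _ _; simp
    | succ p ih =>
      intro s h1 h2
      refine (step F H h T hH hFm hHm hF (fun n => n < p + 1) (fun n => n < p) ?_ s h1 h2).trans ?_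
      · intro i j u hj hA
        have : j ≠ 0 := by rintro rfl; exact hj (hH0 u)
        omega
      · calc _ ≤ 1 + ∫⁻ u in Set.Ioc 0 s, ∑ j ∈ Finset.range p, ENNReal.ofReal ((∫ v in (0:ℝ)..u, h v) ^ j / (j.factorial : ℝ)) * ENNReal.ofReal (h u) := by
              refine add_le_add (by simp) ?_
              apply setLIntegral_mono' measurableSet_Ioc
              intro u hu
              rw [← Finset.sum_mul]
              gcongr
              exact ih u hu.1.le (hu.2.trans h2)
          _ = 1 + ∑ j ∈ Finset.range p, ENNReal.ofReal ((∫ v in (0:ℝ)..s, h v) ^ (j+1) / ((j+1).factorial : ℝ)) := by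
              rw [lintegral_finsetSum' _ (fun j _ => hLmeas s h1 h2 j)]
              congr 1
              exact Finset.sum_congr rfl fun j _ => pow_lint h h0 s h1 (hi' s h1 h2) j
          _ = _ := by
              rw [Finset.sum_range_succ' _ p, add_comm]
              simp
  have hE : ∀ s, 0 ≤ s → s ≤ T → (∑' n, F n s) ≤ ENNReal.ofReal (Real.exp (∫ v in (0:ℝ)..s, h v)) := by
    intro s h1 h2
    apply ENNReal.tsum_le_of_sum_range_le
    intro p
    have e : ∑ n ∈ Finset.range p, F n s = ∑' n, if n < p then F n s else 0 := by
      rw [tsum_eq_sum (s := Finset.range p)]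
      · exact Finset.sum_congr rfl fun n hn => by rw [if_pos (Finset.mem_range.1 hn)]
      · intro n hn
        rw [if_neg (by simpa using hn)]
    rw [e]
    refine (hP p s h1 h2).trans ?_
    have := hL0 s h1
    rw [← ENNReal.ofReal_sum_of_nonneg (fun j _ => by positivity)]
    exact ENNReal.ofReal_le_ofReal (Real.sum_le_exp_of_nonneg this p)
  induction K with
  | zero =>
    intro m _ s h1 h2
    refine le_trans ?_ ((hE s h1 h2).trans (by simp))
    apply ENNReal.tsum_le_tsum
    intro n
    split_ifs <;> simp
  | succ K ih =>
    intro m hm s h1 h2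
    have hm' : K * N < m := by simpa using hm
    refine (step F H h T hH hFm hHm hF (fun n => m ≤ n) (fun n => m - N ≤ n) ?_ s h1 h2).trans ?_
    · intro i j u hj hA
      have : ¬ N < j := fun hj' => hj (hHN j u hj')
      omega
    · have hne : ¬ m ≤ 0 := by omega
      rw [if_neg hne, zero_add]
      calc _ ≤ ∫⁻ u in Set.Ioc 0 s, ENNReal.ofReal (Real.exp (∫ v in (0:ℝ)..s, h v)) *
              (ENNReal.ofReal ((∫ v in (0:ℝ)..u, h v) ^ K / (K.factorial : ℝ)) * ENNReal.ofReal (h u)) := by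
            apply setLIntegral_mono' measurableSet_Ioc
            intro u hu
            rw [← mul_assoc]
            gcongr
            refine (ih (m - N) ?_ u hu.1.le (hu.2.trans h2)).trans ?_
            · rcases K with _ | K
              · simp
              · right
                have : (K + 1) * N = K * N + N := by ring
                simp only [Nat.add_sub_cancel]
                omega
            · rw [ENNReal.ofReal_mul (Real.exp_pos _).le]
              gcongr
              exact hLm s h1 h2 u hu.1.le hu.2
        _ = _ := by
            rw [lintegral_const_mul'' _ (hLmeas s h1 h2 K), pow_lint h h0 s h1 (hi' s h1 h2) K,
              ENNReal.ofReal_mul (Real.exp_pos _).le]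
end core

lemma sqrt_int {ι : Type*} [Fintype ι] (f : ι → ℝ → ℝ) (μ : Measure ℝ)
    (hf : ∀ i, Integrable (f i) μ) :
    ENNReal.ofReal (Real.sqrt (∑ i, (∫ u, f i u ∂μ) ^ 2)) ≤
      ∫⁻ u, ENNReal.ofReal (Real.sqrt (∑ i, (f i u) ^ 2)) ∂μ := by
  let g : ℝ → EuclideanSpace ℝ ι := fun u => WithLp.toLp 2 (fun i => f i u)
  have hg : Integrable g μ := by
    have h1 : Integrable (fun u i => f i u) μ := Integrable.of_eval hf
    exact ((PiLp.continuousLinearEquiv 2 ℝ (fun _ : ι => ℝ)).symm : (ι → ℝ) →L[ℝ] EuclideanSpace ℝ ι).integrable_comp h1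
  have h2 : ∀ i, (∫ u, g u ∂μ) i = ∫ u, f i u ∂μ := by
    intro i
    exact ((EuclideanSpace.proj i : EuclideanSpace ℝ ι →L[ℝ] ℝ).integral_comp_comm hg).symm
  have h3 := enorm_integral_le_lintegral_enorm (μ := μ) g
  simp only [← ofReal_norm, EuclideanSpace.norm_eq, Real.norm_eq_abs, sq_abs, h2] at h3
  exact h3

lemma levelNorm_word {d k m n : ℕ} (hn : k + m = n) (x : Word d k → ℝ) (y : Word d m → ℝ) :
    Real.sqrt (∑ w : Word d n, (x (fun i => w ⟨i.1, by have := i.2; omega⟩) *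
      y (fun i => w ⟨k + i.1, by have := i.2; omega⟩)) ^ 2) =
    Real.sqrt (∑ w, x w ^ 2) * Real.sqrt (∑ w, y w ^ 2) := by
  subst hn
  rw [← Real.sqrt_mul (Finset.sum_nonneg fun _ _ => sq_nonneg _)]
  congr 1
  rw [← (Fin.appendEquiv k m).sum_comp, Fintype.sum_prod_type, Finset.sum_mul_sum]
  refine Finset.sum_congr rfl fun a _ => Finset.sum_congr rfl fun b _ => ?_
  rw [mul_pow]
  congr 3
  · ext i; congr 1; exact Fin.append_left a b i
  · ext i; congr 1; exact Fin.append_right a b i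

lemma sqrt_sum_le {ι κ : Type*} [Fintype ι] (s : Finset κ) (f : κ → ι → ℝ) :
    Real.sqrt (∑ i, (∑ k ∈ s, f k i) ^ 2) ≤ ∑ k ∈ s, Real.sqrt (∑ i, (f k i) ^ 2) := by
  have := norm_sum_le s (fun k => (WithLp.toLp 2 (f k) : EuclideanSpace ℝ ι))
  simpa [EuclideanSpace.norm_eq] using this

lemma levelNorm_nonneg {d : ℕ} (x : TS d) (n : ℕ) : 0 ≤ TS.levelNorm x n := Real.sqrt_nonneg _

lemma levelNorm_mul {d : ℕ} (x y : TS d) (n : ℕ) :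
    TS.levelNorm (TS.mul x y) n ≤
      ∑ p ∈ Finset.HasAntidiagonal.antidiagonal n, TS.levelNorm x p.1 * TS.levelNorm y p.2 := by
  rw [Finset.Nat.sum_antidiagonal_eq_sum_range_succ (fun i j => TS.levelNorm x i * TS.levelNorm y j),
    Finset.sum_range]
  unfold TS.levelNorm TS.mul
  refine (sqrt_sum_le _ _).trans (le_of_eq ?_)
  refine Finset.sum_congr rfl fun k _ => ?_
  exact levelNorm_word (by have := k.2; omega) (x k.1) (y (n - k.1))

lemma pNorm_one {d : ℕ} (x : TS d) : TS.pNorm 1 x = ∑' n, ENNReal.ofReal (TS.levelNorm x n) := by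
  simp [TS.pNorm]

lemma levelNorm_one {d : ℕ} (n : ℕ) : TS.levelNorm (TS.one : TS d) n = if n = 0 then 1 else 0 := by
  rcases n with _ | n <;> simp [TS.levelNorm, TS.one]

lemma levelNorm_add {d : ℕ} (x y : TS d) (n : ℕ) :
    TS.levelNorm (TS.add x y) n ≤ TS.levelNorm x n + TS.levelNorm y n := by
  have := sqrt_sum_le (Finset.univ : Finset (Fin 2)) (fun k => if k = 0 then x n else y n)
  simpa [TS.levelNorm, TS.add] using this

lemma levelNorm_truncate {d : ℕ} (N : ℕ) (x : TS d) (n : ℕ) :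
    TS.levelNorm (TS.truncate N x) n = if n ≤ N then TS.levelNorm x n else 0 := by
  unfold TS.levelNorm TS.truncate
  split_ifs <;> simp

lemma levelNorm_le {d : ℕ} (x : TS d) (n : ℕ) : TS.levelNorm x n ≤ ∑ w, |x n w| := by
  unfold TS.levelNorm
  rw [Real.sqrt_le_left (Finset.sum_nonneg fun _ _ => abs_nonneg _)]
  calc _ = ∑ w, |x n w| ^ 2 := by simp
    _ ≤ _ := Finset.sum_sq_le_sq_sum_of_nonneg fun _ _ => abs_nonneg _

end TSaux

theorem free_development_outer_truncation (d : ℕ) (γ' : ℝ → TS d)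
    (hγ0 : ∀ u w, γ' u 0 w = 0)
    (hγmeas : ∀ n w, Measurable fun u => γ' u n w)
    (hγint : ∀ a b n w, IntervalIntegrable (fun u => γ' u n w) volume a b)
    (t : ℝ) (ht : 0 ≤ t)
    (hfin : ∫⁻ u in Set.Ioc (0:ℝ) t, TS.pNorm 1 (γ' u) ≠ ⊤)
    (M N : ℕ) (hN : 1 ≤ N) (hMN : N ≤ M)
    (S : ℝ → TS d)
    (hS : TS.IsDev (fun u => TS.truncate N (γ' u)) 0 S) :
    TS.pNorm 1 (TS.sub (S t) (TS.truncate (M - 1) (S t))) ≤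
      ENNReal.ofReal
        (Real.exp (∫⁻ u in Set.Ioc (0:ℝ) t, TS.pNorm 1 (TS.truncate N (γ' u))).toReal *
          ((∫⁻ u in Set.Ioc (0:ℝ) t, TS.pNorm 1 (TS.truncate N (γ' u))).toReal ^ ((M + N - 1) / N)
            / (((M + N - 1) / N).factorial : ℝ))) := by
  obtain ⟨hSi, hSe⟩ := hS
  let h : ℝ → ℝ := fun u => ∑ n ∈ Finset.range (N+1), TS.levelNorm (γ' u) n
  have h0 : ∀ u, 0 ≤ h u := fun u => Finset.sum_nonneg fun n _ => TSaux.levelNorm_nonneg _ _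
  have hlm : ∀ n, Measurable fun u => TS.levelNorm (γ' u) n := by
    intro n
    unfold TS.levelNorm
    exact (Finset.measurable_fun_sum _ fun w _ => (hγmeas n w).pow_const 2).sqrt
  have hi : IntervalIntegrable h volume 0 t := by
    have hn : ∀ n, IntervalIntegrable (fun u => TS.levelNorm (γ' u) n) volume 0 t := by
      intro n
      have h1 : IntervalIntegrable (fun u => ∑ w, |γ' u n w|) volume 0 t := by
        have := IntervalIntegrable.sum (μ := volume) (a := 0) (b := t) Finset.univ
          (f := fun w u => |γ' u n w|) (fun w _ => (hγint 0 t n w).abs)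
        have e : (fun u => ∑ w, |γ' u n w|) = ∑ w, fun u => |γ' u n w| := by
          ext u; simp
        rw [e]; exact this
      refine h1.mono_fun (hlm n).aestronglyMeasurable (Filter.Eventually.of_forall fun u => ?_)
      simp only [Real.norm_eq_abs]
      rw [abs_of_nonneg (TSaux.levelNorm_nonneg _ _)]
      exact (TSaux.levelNorm_le _ _).trans (le_abs_self _)
    have := IntervalIntegrable.sum (μ := volume) (a := 0) (b := t) (Finset.range (N+1))
          (f := fun n u => TS.levelNorm (γ' u) n) (fun n _ => hn n)
    have e : h = ∑ n ∈ Finset.range (N+1), fun u => TS.levelNorm (γ' u) n := by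
      ext u; simp [h]
    rw [e]; exact this
  have hH : ∀ u, ∑' n, ENNReal.ofReal (TS.levelNorm (TS.truncate N (γ' u)) n) = ENNReal.ofReal (h u) := by
    intro u
    rw [tsum_eq_sum (s := Finset.range (N+1))]
    · rw [ENNReal.ofReal_sum_of_nonneg fun n _ => TSaux.levelNorm_nonneg _ _]
      refine Finset.sum_congr rfl fun n hn => ?_
      rw [TSaux.levelNorm_truncate, if_pos (by simpa [Nat.lt_succ_iff] using hn)]
    · intro n hn
      rw [TSaux.levelNorm_truncate, if_neg (by simpa [Nat.lt_succ_iff] using hn)]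
      simp
  have hL : (∫⁻ u in Set.Ioc (0:ℝ) t, TS.pNorm 1 (TS.truncate N (γ' u))).toReal = ∫ v in (0:ℝ)..t, h v := by
    simp_rw [TSaux.pNorm_one, hH]
    rw [← ofReal_integral_eq_lintegral_ofReal ((intervalIntegrable_iff_integrableOn_Ioc_of_le ht).1 hi)
      (Filter.Eventually.of_forall h0), ← intervalIntegral.integral_of_le ht, ENNReal.toReal_ofReal]
    exact intervalIntegral.integral_nonneg ht (fun v _ => h0 v)
  rw [hL, TSaux.pNorm_one]
  have hsub : ∀ n, ENNReal.ofReal (TS.levelNorm (TS.sub (S t) (TS.truncate (M - 1) (S t))) n)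
      = if M ≤ n then ENNReal.ofReal (TS.levelNorm (S t) n) else 0 := by
    intro n
    unfold TS.levelNorm TS.sub TS.truncate
    by_cases hn : M ≤ n
    · have : ¬ n ≤ M - 1 := by omega
      simp [hn, this]
    · have : n ≤ M - 1 := by omega
      simp [hn, this]
  simp_rw [hsub]
  refine TSaux.core (fun n u => ENNReal.ofReal (TS.levelNorm (S u) n))
    (fun n u => ENNReal.ofReal (TS.levelNorm (TS.truncate N (γ' u)) n)) h N t hN h0 hi hH
    ?_ ?_ ?_ ?_ ?_ _ M ?_ t ht le_rfl
  · intro n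
    apply AEMeasurable.ennreal_ofReal
    apply ContinuousOn.aemeasurable _ measurableSet_Ioc
    unfold TS.levelNorm
    apply ContinuousOn.sqrt
    apply continuousOn_finsetSum
    intro w _
    apply ContinuousOn.pow
    have h1 := intervalIntegral.continuousOn_primitive_interval'
      (hSi t n w) (a := 0) (by simp)
    rw [Set.uIcc_of_le ht] at h1
    refine ((continuousOn_const (c := (TS.one : TS d) n w)).add (h1.mono Set.Ioc_subset_Icc_self)).congr ?_
    intro u hu
    exact hSe u hu.1.le n w
  · intro n
    apply Measurable.ennreal_ofReal
    simp_rw [TSaux.levelNorm_truncate]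
    split_ifs
    · exact hlm n
    · exact measurable_const
  · intro u
    simp [TS.truncate, TS.levelNorm, hγ0]
  · intro n u hn
    simp [TSaux.levelNorm_truncate, not_le.2 hn]
  · intro s hs _ n
    have e : TS.levelNorm (S s) n = TS.levelNorm (TS.add TS.one
        (fun n w => ∫ u in Set.Ioc 0 s, TS.mul (S u) (TS.truncate N (γ' u)) n w)) n := by
      unfold TS.levelNorm TS.add
      congr 2
      ext w
      rw [hSe s hs n w, intervalIntegral.integral_of_le hs]
    rw [e]
    refine (ENNReal.ofReal_le_ofReal (TSaux.levelNorm_add _ _ _)).trans ?_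
    refine ENNReal.ofReal_add_le.trans ?_
    refine add_le_add ?_ ?_
    · rw [TSaux.levelNorm_one]; split_ifs <;> simp
    · refine (TSaux.sqrt_int (fun w u => TS.mul (S u) (TS.truncate N (γ' u)) n w)
        (volume.restrict (Set.Ioc 0 s)) fun w =>
          (intervalIntegrable_iff_integrableOn_Ioc_of_le hs).1 (hSi s n w)).trans ?_
      apply lintegral_mono
      intro u
      refine (ENNReal.ofReal_le_ofReal (TSaux.levelNorm_mul _ _ _)).trans ?_
      rw [ENNReal.ofReal_sum_of_nonneg fun p _ =>
        mul_nonneg (TSaux.levelNorm_nonneg _ _) (TSaux.levelNorm_nonneg _ _)]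
      exact Finset.sum_le_sum fun p _ => (ENNReal.ofReal_mul (TSaux.levelNorm_nonneg _ _)).le
  · right
    have h1 : (M + N - 1) / N * N ≤ M + N - 1 := Nat.div_mul_le_self _ _
    rw [Nat.sub_mul]
    omega
end
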